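/- arXiv:2603.26455 — 2 statements merged into one kernel-verified Lean document; each statement's English description precedes it below -/
import Mathlib

section
/- Let M be a tempered weight on ℝ^{4d} and Φ ∈ S₀(M). For every Schwartz function F ∈ 𝒮(ℝ^{2d};ℂ) and every (α̃,β̃) ∈ (ℤ^d×ℤ^d)², the series N_{α̃,β̃} := Σ_{(γ̃,δ̃)∈(ℤ^d×ℤ^d)²} 𝕄_{(α̃,β̃),(γ̃,δ̃)}[Φ] · c_{γ̃,δ̃}(F) converges absolutely, and for every n ∈ ℕ one has sup_{(α̃,β̃)} ⟨(α̃,β̃)⟩^n · |N_{α̃,β̃}| < ∞. (In frame coordinates this says that the magnetic pseudo-differential super operator Op^A(Φ) maps smoothing operators to smoothing operators.) -/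
open MeasureTheory Filter
open scoped ENNReal

noncomputable section

/-- Japanese bracket `⟨v⟩ = √(1+‖v‖²)` with the Euclidean norm on `ℝ^N`. -/
def jbV {N : ℕ} (v : Fin N → ℝ) : ℝ := Real.sqrt (1 + ∑ i, v i ^ 2)

/-- A tempered weight on `ℝ^N`: a positive function `m` with
`m(u+v) ≤ C·m(u)·⟨v⟩^a` for some `C, a > 0`. -/
def IsTemperedWeight {N : ℕ} (m : (Fin N → ℝ) → ℝ) : Prop :=
  (∀ u, 0 < m u) ∧ ∃ C > 0, ∃ a : ℝ, 0 < a ∧ ∀ u v, m (u + v) ≤ C * m u * jbV v ^ a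

/-- A regular magnetic field on `ℝ^d`: smooth, antisymmetric, closed, with all
derivatives of all components bounded. -/
structure IsRegularMagneticField (d : ℕ) (B : Fin d → Fin d → (Fin d → ℝ) → ℝ) : Prop where
  smooth : ∀ j k, ContDiff ℝ (⊤ : ℕ∞) (B j k)
  antisymm : ∀ j k x, B j k x = - B k j x
  closed : ∀ i j k, ∀ x : Fin d → ℝ,
      fderiv ℝ (B j k) x (Pi.single i 1) + fderiv ℝ (B k i) x (Pi.single j 1)
        + fderiv ℝ (B i j) x (Pi.single k 1) = 0
  derivBounded : ∀ j k, ∀ n : ℕ, ∃ C : ℝ, ∀ x, ‖iteratedFDeriv ℝ n (B j k) x‖ ≤ C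

/-- The transversal-gauge vector potential based at `y`:
`A_k(x;y) = Σ_j ∫₀¹ s·(x_j−y_j)·B_{jk}(y+s(x−y)) ds`. -/
def magA (d : ℕ) (B : Fin d → Fin d → (Fin d → ℝ) → ℝ) (y x : Fin d → ℝ) (k : Fin d) : ℝ :=
  ∑ j, ∫ s in (0:ℝ)..1, s * (x j - y j) * B j k (y + s • (x - y))

/-- The circulation `φ(x,y) = Σ_k ∫₀¹ A_k(y+s(x−y))·(x_k−y_k) ds` of `A = A(·;0)`
along the segment from `y` to `x`. -/
def magPhi (d : ℕ) (B : Fin d → Fin d → (Fin d → ℝ) → ℝ) (x y : Fin d → ℝ) : ℝ :=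
  ∑ k, ∫ s in (0:ℝ)..1, magA d B 0 (y + s • (x - y)) k * (x k - y k)

/-- A window function for the magnetic Gabor frame: smooth, compactly supported in
`(−1,1)^d`, with `Σ_{α∈ℤ^d} 𝔤(x−α)² = 1`. -/
structure IsWindow (d : ℕ) (g : (Fin d → ℝ) → ℝ) : Prop where
  smooth : ContDiff ℝ (⊤ : ℕ∞) g
  compactSupport : HasCompactSupport g
  support_subset : ∀ x : Fin d → ℝ, g x ≠ 0 → ∀ i, |x i| < 1
  partition : ∀ x : Fin d → ℝ, ∑' α : Fin d → ℤ, (g (x - fun i => (α i : ℝ))) ^ 2 = 1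

abbrev Idx (d : ℕ) := (Fin d → ℤ) × (Fin d → ℤ)
abbrev Idx2 (d : ℕ) := Idx d × Idx d
abbrev E1 (d : ℕ) := Fin d → ℝ
abbrev E2 (d : ℕ) := E1 d × E1 d
abbrev E4 (d : ℕ) := E2 d × E2 d

/-- The magnetic Gabor function
`𝒢_α̃(x) = (2π)^{−d/2}·e^{iφ(x,α)}·𝔤(x−α)·e^{iα'·(x−α)}` for `α̃ = (α,α')`. -/
def gabor (d : ℕ) (B : Fin d → Fin d → E1 d → ℝ) (g : E1 d → ℝ) (a : Idx d) (x : E1 d) : ℂ :=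
  (((2 * Real.pi) ^ (-(d : ℝ) / 2) : ℝ) : ℂ) *
    Complex.exp (Complex.I * (magPhi d B x (fun i => (a.1 i : ℝ)) : ℂ)) *
    ((g (x - fun i => (a.1 i : ℝ)) : ℝ) : ℂ) *
    Complex.exp (Complex.I * ((∑ i, (a.2 i : ℝ) * (x i - (a.1 i : ℝ)) : ℝ) : ℂ))

/-- `G_{α̃,β̃}(x,y) = 𝒢_α̃(x)·conj(𝒢_β̃(y))`. -/
def gaborTensor (d : ℕ) (B : Fin d → Fin d → E1 d → ℝ) (g : E1 d → ℝ) (a b : Idx d)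
    (p : E2 d) : ℂ :=
  gabor d B g a p.1 * (starRingEnd ℂ) (gabor d B g b p.2)

/-- `T_{α̃,β̃}(x,y) = conj(𝒢_α̃(x))·𝒢_β̃(y)`. -/
def gaborDual (d : ℕ) (B : Fin d → Fin d → E1 d → ℝ) (g : E1 d → ℝ) (a b : Idx d)
    (p : E2 d) : ℂ :=
  (starRingEnd ℂ) (gabor d B g a p.1) * gabor d B g b p.2

/-- The frame coefficient `c_{α̃,β̃}(F) = ∫ F(x,y)·conj(𝒢_α̃(x))·𝒢_β̃(y) dx dy`. -/
def frameCoef (d : ℕ) (B : Fin d → Fin d → E1 d → ℝ) (g : E1 d → ℝ) (a b : Idx d)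
    (F : E2 d → ℂ) : ℂ :=
  ∫ p : E2 d, F p * (starRingEnd ℂ) (gabor d B g a p.1) * gabor d B g b p.2

/-- `⟨(α̃,β̃)⟩` with `(α̃,β̃)` regarded as a point of `ℝ^{4d}`. -/
def jbIdxPair (d : ℕ) (a b : Idx d) : ℝ :=
  Real.sqrt (1 + (∑ i, ((a.1 i : ℝ)) ^ 2) + (∑ i, ((a.2 i : ℝ)) ^ 2)
    + (∑ i, ((b.1 i : ℝ)) ^ 2) + ∑ i, ((b.2 i : ℝ)) ^ 2)

/-- Euclidean Japanese bracket on `ℝ^{4d} = E4 d`. -/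
def jbE4 (d : ℕ) (v : E4 d) : ℝ :=
  Real.sqrt (1 + (∑ i, v.1.1 i ^ 2) + (∑ i, v.1.2 i ^ 2) + (∑ i, v.2.1 i ^ 2) + ∑ i, v.2.2 i ^ 2)

/-- A tempered weight on `ℝ^{4d}`. -/
def IsTemperedWeightE4 (d : ℕ) (M : E4 d → ℝ) : Prop :=
  (∀ u, 0 < M u) ∧ ∃ C > 0, ∃ a : ℝ, 0 < a ∧ ∀ u v, M (u + v) ≤ C * M u * jbE4 d v ^ a

/-- Euclidean Japanese bracket on `ℝ^N × ℝ^N`. -/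
def jbP {N : ℕ} (v : (Fin N → ℝ) × (Fin N → ℝ)) : ℝ :=
  Real.sqrt (1 + (∑ i, v.1 i ^ 2) + ∑ i, v.2 i ^ 2)

/-- A tempered weight on `ℝ^N × ℝ^N ≅ ℝ^{2N}`. -/
def IsTemperedWeightProd {N : ℕ} (m : (Fin N → ℝ) × (Fin N → ℝ) → ℝ) : Prop :=
  (∀ u, 0 < m u) ∧ ∃ C > 0, ∃ a : ℝ, 0 < a ∧ ∀ u v, m (u + v) ≤ C * m u * jbP v ^ a

/-- `⟨(α̃,β̃) − (γ̃,δ̃)⟩` for pairs of indices in `ℤ^{2d} × ℤ^{2d}`. -/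
def jbDiffIdx2 (d : ℕ) (p q : Idx2 d) : ℝ :=
  Real.sqrt (1 + (∑ i, ((p.1.1 i - q.1.1 i : ℤ) : ℝ) ^ 2) + (∑ i, ((p.1.2 i - q.1.2 i : ℤ) : ℝ) ^ 2)
    + (∑ i, ((p.2.1 i - q.2.1 i : ℤ) : ℝ) ^ 2) + ∑ i, ((p.2.2 i - q.2.2 i : ℤ) : ℝ) ^ 2)

/-- The midpoint `((α̃,β̃)+(γ̃,δ̃))/2 ∈ ℝ^{4d}`. -/
def midIdx2 (d : ℕ) (p q : Idx2 d) : E4 d :=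
  ((fun i => ((p.1.1 i + q.1.1 i : ℤ) : ℝ) / 2, fun i => ((p.1.2 i + q.1.2 i : ℤ) : ℝ) / 2),
   (fun i => ((p.2.1 i + q.2.1 i : ℤ) : ℝ) / 2, fun i => ((p.2.2 i + q.2.2 i : ℤ) : ℝ) / 2))

/-- Membership in the Hörmander class `S₀(M)` on `ℝ^{4d}`: smooth, with all
derivatives dominated by `M`. -/
def InS0 (d : ℕ) (M : E4 d → ℝ) (Φ : E4 d → ℂ) : Prop :=
  ContDiff ℝ (⊤ : ℕ∞) Φ ∧ ∀ n : ℕ, ∃ C : ℝ, ∀ X, ‖iteratedFDeriv ℝ n Φ X‖ ≤ C * M X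

/-- The seminorms `‖Φ‖_{S₀(M),k}`. -/
def s0Seminorm (d : ℕ) (M : E4 d → ℝ) (k : ℕ) (Φ : E4 d → ℂ) : ℝ :=
  ∑ n ∈ Finset.range (k + 1), ⨆ X : E4 d, ‖iteratedFDeriv ℝ n Φ X‖ / M X

/-- The integrand of the inner (oscillatory) integral defining `H_{(α̃,β̃),(γ̃,δ̃)}`,
evaluated at `X = ((v_L,ξ_L),(v_R,ξ_R))` and `z = (z_L,z_R)`. -/
def gaborKernel4 (d : ℕ) (B : Fin d → Fin d → E1 d → ℝ) (g : E1 d → ℝ) (ab gd : Idx2 d)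
    (X : E4 d) (z : E2 d) : ℂ :=
  Complex.exp (Complex.I * (((∑ i, X.1.2 i * z.1 i) - ∑ i, X.2.2 i * z.2 i : ℝ) : ℂ)) *
  Complex.exp (Complex.I * ((magPhi d B (X.1.1 + (2 : ℝ)⁻¹ • z.1) (X.1.1 - (2 : ℝ)⁻¹ • z.1)
      - magPhi d B (X.2.1 + (2 : ℝ)⁻¹ • z.2) (X.2.1 - (2 : ℝ)⁻¹ • z.2) : ℝ) : ℂ)) *
  gabor d B g gd.1 (X.1.1 + (2 : ℝ)⁻¹ • z.1) *
  (starRingEnd ℂ) (gabor d B g gd.2 (X.2.1 + (2 : ℝ)⁻¹ • z.2)) *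
  (starRingEnd ℂ) (gabor d B g ab.1 (X.1.1 - (2 : ℝ)⁻¹ • z.1)) *
  gabor d B g ab.2 (X.2.1 - (2 : ℝ)⁻¹ • z.2)

/-- The kernel `H_{(α̃,β̃),(γ̃,δ̃)}` on `ℝ^{4d}`. -/
def matH (d : ℕ) (B : Fin d → Fin d → E1 d → ℝ) (g : E1 d → ℝ) (ab gd : Idx2 d)
    (X : E4 d) : ℂ :=
  (((2 * Real.pi) ^ (-(2 * (d : ℝ))) : ℝ) : ℂ) * ∫ z : E2 d, gaborKernel4 d B g ab gd X z

/-- The matrix element `𝕄_{(α̃,β̃),(γ̃,δ̃)}[Φ] = ∫ Φ·H_{(α̃,β̃),(γ̃,δ̃)}`. -/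
def matElem (d : ℕ) (B : Fin d → Fin d → E1 d → ℝ) (g : E1 d → ℝ) (Φ : E4 d → ℂ)
    (ab gd : Idx2 d) : ℂ :=
  ∫ X : E4 d, Φ X * matH d B g ab gd X

/-- The dequantized frame symbol
`g_{α̃,γ̃}(v,ξ) = ∫ e^{−iξ·z}·e^{−iφ(v+z/2,v−z/2)}·𝒢_α̃(v+z/2)·conj(𝒢_γ̃(v−z/2)) dz`. -/
def deqSymbol (d : ℕ) (B : Fin d → Fin d → E1 d → ℝ) (g : E1 d → ℝ) (ac : Idx d × Idx d)
    (vξ : E2 d) : ℂ :=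
  ∫ z : E1 d,
    Complex.exp (-Complex.I * ((∑ i, vξ.2 i * z i : ℝ) : ℂ)) *
    Complex.exp (-Complex.I * ((magPhi d B (vξ.1 + (2 : ℝ)⁻¹ • z) (vξ.1 - (2 : ℝ)⁻¹ • z) : ℝ) : ℂ)) *
    gabor d B g ac.1 (vξ.1 + (2 : ℝ)⁻¹ • z) *
    (starRingEnd ℂ) (gabor d B g ac.2 (vξ.1 - (2 : ℝ)⁻¹ • z))

section Auxiliary

open scoped ContDiff

/-- A directional derivative loses at most a factor `‖u‖`. -/
theorem norm_iteratedFDeriv_fderiv_apply_le {E F : Type*} [NormedAddCommGroup E] [NormedSpace ℝ E]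
    [NormedAddCommGroup F] [NormedSpace ℝ F] {f : E → F} (hf : ContDiff ℝ ∞ f) (u x : E) (n : ℕ) :
    ‖iteratedFDeriv ℝ n (fun y => fderiv ℝ f y u) x‖ ≤ ‖u‖ * ‖iteratedFDeriv ℝ (n + 1) f x‖ := by
  have h : ContDiff ℝ ∞ (fderiv ℝ f) := hf.fderiv_right (by simp)
  refine (norm_iteratedFDeriv_clm_apply_const (N := ∞) h.contDiffAt (mod_cast le_top)).trans ?_
  rw [norm_iteratedFDeriv_fderiv]

theorem ContDiff.fderiv_apply_const_infty {E F : Type*} [NormedAddCommGroup E] [NormedSpace ℝ E]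
    [NormedAddCommGroup F] [NormedSpace ℝ F] {f : E → F} (hf : ContDiff ℝ ∞ f) (u : E) :
    ContDiff ℝ ∞ (fun y => fderiv ℝ f y u) :=
  (hf.fderiv_right (m := ∞) (by simp)).clm_apply contDiff_const

section IntegrationByParts

variable {V : Type*} [NormedAddCommGroup V] [NormedSpace ℝ V] [FiniteDimensional ℝ V]
  [MeasureSpace V] [BorelSpace V] [(volume : Measure V).IsAddHaarMeasure]

theorem integral_mul_fderiv_of_hasCompactSupport {e f : V → ℂ} (he : ContDiff ℝ ∞ e)
    (hf : ContDiff ℝ ∞ f) (hfc : HasCompactSupport f) (u : V) :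
    ∫ x, e x * fderiv ℝ f x u = -∫ x, fderiv ℝ e x u * f x := by
  have hf' := (hf.fderiv_apply_const_infty u).continuous
  have he' := (he.fderiv_apply_const_infty u).continuous
  have hfc' : HasCompactSupport fun x => fderiv ℝ f x u := hfc.fderiv_apply ℝ u
  refine integral_mul_fderiv_eq_neg_fderiv_mul_of_integrable ?_ ?_ ?_ ?_ ?_
  · exact (he'.mul hf.continuous).integrable_of_hasCompactSupport hfc.mul_left
  · exact (he.continuous.mul hf').integrable_of_hasCompactSupport hfc'.mul_left
  · exact (he.continuous.mul hf.continuous).integrable_of_hasCompactSupport hfc.mul_left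
  · exact fun x _ => he.differentiable (by simp) x
  · exact fun x _ => hf.differentiable (by simp) x

theorem fderiv_cexp_I_mul {E : Type*} [NormedAddCommGroup E] [NormedSpace ℝ E] {θ : E → ℝ}
    (hθ : Differentiable ℝ θ) (x u : E) :
    fderiv ℝ (fun y => Complex.exp (Complex.I * (θ y : ℂ))) x u
      = Complex.I * (fderiv ℝ θ x u : ℂ) * Complex.exp (Complex.I * (θ x : ℂ)) := by
  have h1 : HasFDerivAt (fun y => (θ y : ℂ)) (Complex.ofRealCLM.comp (fderiv ℝ θ x)) x :=
    Complex.ofRealCLM.hasFDerivAt.comp x (hθ x).hasFDerivAt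
  have h2 := ((h1.const_mul Complex.I).cexp).fderiv
  rw [h2]
  simp
  ring

theorem contDiff_cexp_I_mul {E : Type*} [NormedAddCommGroup E] [NormedSpace ℝ E] {θ : E → ℝ}
    (hθ : ContDiff ℝ ∞ θ) : ContDiff ℝ ∞ fun y => Complex.exp (Complex.I * (θ y : ℂ)) :=
  (contDiff_const.mul (Complex.ofRealCLM.contDiff.comp hθ)).cexp

theorem norm_cexp_I_mul (t : ℝ) : ‖Complex.exp (Complex.I * (t : ℂ))‖ = 1 := by
  rw [mul_comm]; exact Complex.norm_exp_ofReal_mul_I t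

/-- Decay of the Fourier transform of a test function at the frequency `l`. -/
theorem pow_abs_mul_norm_integral_cexp_mul_le (l : V →L[ℝ] ℝ) {u : V} (hu : ‖u‖ ≤ 1) (n : ℕ)
    {f : V → ℂ} (hf : ContDiff ℝ ∞ f) (hfc : HasCompactSupport f) :
    |l u| ^ n * ‖∫ x, Complex.exp (Complex.I * (l x : ℂ)) * f x‖
      ≤ ∫ x, ‖iteratedFDeriv ℝ n f x‖ := by
  induction n generalizing f with
  | zero =>
    simp only [pow_zero, one_mul, norm_iteratedFDeriv_zero]
    refine (norm_integral_le_integral_norm _).trans_eq ?_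
    simp
  | succ n ih =>
    have hparts := integral_mul_fderiv_of_hasCompactSupport
      (contDiff_cexp_I_mul (θ := fun x => l x) l.contDiff) hf hfc u
    have hD : ∀ x, fderiv ℝ (fun y => Complex.exp (Complex.I * (l y : ℂ))) x u * f x
        = Complex.I * (l u : ℂ) * (Complex.exp (Complex.I * (l x : ℂ)) * f x) := fun x => by
      rw [fderiv_cexp_I_mul l.differentiable]
      simp only [ContinuousLinearMap.fderiv]
      ring
    simp only [hD, integral_const_mul] at hparts
    have hnorm : |l u| * ‖∫ x, Complex.exp (Complex.I * (l x : ℂ)) * f x‖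
        = ‖∫ x, Complex.exp (Complex.I * (l x : ℂ)) * fderiv ℝ f x u‖ := by
      rw [hparts]; simp
    have hf'c : HasCompactSupport fun x => fderiv ℝ f x u := hfc.fderiv_apply ℝ u
    have hf' := hf.fderiv_apply_const_infty u
    rw [pow_succ, mul_assoc, hnorm]
    refine (ih hf' hf'c).trans (integral_mono ?_ ?_ fun x => ?_)
    · exact ((hf'.continuous_iteratedFDeriv (m := n) (mod_cast le_top)).norm).integrable_of_hasCompactSupport
        (hf'c.iteratedFDeriv n).norm
    · exact ((hf.continuous_iteratedFDeriv (m := n + 1) (mod_cast le_top)).norm).integrable_of_hasCompactSupport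
        (hfc.iteratedFDeriv (n + 1)).norm
    · refine (norm_iteratedFDeriv_fderiv_apply_le hf u x n).trans ?_
      exact mul_le_of_le_one_left (norm_nonneg _) hu

end IntegrationByParts

/-- If two functions have derivatives up to order `n` bounded by `A`, resp. `B`, at a point, then
their product has derivatives up to order `n` bounded by `2 ^ n * A * B` at that point. -/
theorem norm_iteratedFDeriv_mul_le_of_bounds {E : Type*} [NormedAddCommGroup E] [NormedSpace ℝ E]
    {a b : E → ℂ} (ha : ContDiff ℝ ∞ a) (hb : ContDiff ℝ ∞ b) {A B : ℝ} {n : ℕ} {x : E}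
    (hA : ∀ k ≤ n, ‖iteratedFDeriv ℝ k a x‖ ≤ A) (hB : ∀ k ≤ n, ‖iteratedFDeriv ℝ k b x‖ ≤ B)
    {k : ℕ} (hk : k ≤ n) :
    ‖iteratedFDeriv ℝ k (fun y => a y * b y) x‖ ≤ 2 ^ n * A * B := by
  have hA0 : 0 ≤ A := (norm_nonneg _).trans (hA 0 (Nat.zero_le _))
  have hB0 : 0 ≤ B := (norm_nonneg _).trans (hB 0 (Nat.zero_le _))
  calc ‖iteratedFDeriv ℝ k (fun y => a y * b y) x‖
      ≤ ∑ i ∈ Finset.range (k + 1), (k.choose i : ℝ) * ‖iteratedFDeriv ℝ i a x‖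
          * ‖iteratedFDeriv ℝ (k - i) b x‖ :=
        norm_iteratedFDeriv_mul_le (N := ∞) ha hb x (mod_cast le_top)
    _ ≤ ∑ i ∈ Finset.range (k + 1), (k.choose i : ℝ) * A * B := by
        refine Finset.sum_le_sum fun i hi => ?_
        have hi' : i ≤ k := by simpa [Nat.lt_succ_iff] using hi
        gcongr
        · exact hA i (hi'.trans hk)
        · exact hB _ ((Nat.sub_le _ _).trans hk)
    _ = 2 ^ k * A * B := by
        rw [← Finset.sum_mul, ← Finset.sum_mul]
        congr 2
        exact_mod_cast Nat.sum_range_choose k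
    _ ≤ 2 ^ n * A * B := by
        gcongr
        norm_num

/-- Precomposition with an affine map of linear part of norm at most one. -/
theorem norm_iteratedFDeriv_comp_affine_le {E F G : Type*} [NormedAddCommGroup E] [NormedSpace ℝ E]
    [NormedAddCommGroup F] [NormedSpace ℝ F] [NormedAddCommGroup G] [NormedSpace ℝ G] {f : F → G}
    (hf : ContDiff ℝ ∞ f) (L : E →L[ℝ] F) (hL : ‖L‖ ≤ 1) (b : F) (k : ℕ) (x : E) :
    ‖iteratedFDeriv ℝ k (fun y => f (L y + b)) x‖ ≤ ‖iteratedFDeriv ℝ k f (L x + b)‖ := by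
  have h1 : ContDiff ℝ ∞ fun y => f (y + b) := hf.comp (contDiff_id.add contDiff_const)
  have h2 : iteratedFDeriv ℝ k (fun y => f (L y + b)) x
      = (iteratedFDeriv ℝ k (fun y => f (y + b)) (L x)).compContinuousLinearMap fun _ => L :=
    L.iteratedFDeriv_comp_right h1 x (mod_cast le_top)
  rw [h2, iteratedFDeriv_comp_add_right]
  refine (ContinuousMultilinearMap.norm_compContinuousLinearMap_le _ _).trans ?_
  refine mul_le_of_le_one_right (norm_nonneg _) ?_
  simpa using pow_le_one₀ (norm_nonneg L) hL

theorem one_add_pow_mul_one_add_pow_le {a b I B : ℝ} (ha : 0 ≤ a) (hb : 0 ≤ b) (hI : 0 ≤ I)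
    (N : ℕ) (h0 : I ≤ B) (h1 : a ^ (2 * N) * I ≤ B) (h2 : b ^ (2 * N) * I ≤ B) :
    (1 + a) ^ N * (1 + b) ^ N * I ≤ 4 * 2 ^ (2 * N) * B := by
  have key : ∀ t : ℝ, 0 ≤ t → t ^ (2 * N) * I ≤ B → (1 + t) ^ (2 * N) * I ≤ 2 * 2 ^ (2 * N) * B := by
    intro t ht h
    have h3 : (1 + t) ^ (2 * N) ≤ 2 ^ (2 * N) * (1 + t ^ (2 * N)) := by
      have h4 := add_pow_le (zero_le_one (α := ℝ)) ht (2 * N)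
      rw [one_pow] at h4
      refine h4.trans ?_
      gcongr
      · norm_num
      · exact Nat.sub_le _ _
    calc (1 + t) ^ (2 * N) * I ≤ 2 ^ (2 * N) * (1 + t ^ (2 * N)) * I := by gcongr
      _ = 2 ^ (2 * N) * (I + t ^ (2 * N) * I) := by ring
      _ ≤ 2 ^ (2 * N) * (B + B) := by gcongr
      _ = _ := by ring
  have h5 : (1 + a) ^ N * (1 + b) ^ N ≤ (1 + a) ^ (2 * N) + (1 + b) ^ (2 * N) := by
    have := sq_nonneg ((1 + a) ^ N - (1 + b) ^ N)
    rw [mul_comm 2 N, pow_mul, pow_mul]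
    nlinarith [sq_nonneg ((1 + a) ^ N), sq_nonneg ((1 + b) ^ N)]
  calc (1 + a) ^ N * (1 + b) ^ N * I ≤ ((1 + a) ^ (2 * N) + (1 + b) ^ (2 * N)) * I := by gcongr
    _ ≤ 2 * 2 ^ (2 * N) * B + 2 * 2 ^ (2 * N) * B := by
        rw [add_mul]; exact add_le_add (key a ha h1) (key b hb h2)
    _ = _ := by ring

section Oscillatory

variable {V : Type*} [NormedAddCommGroup V] [NormedSpace ℝ V]

/-- The oscillatory integral `∫ e^{i(β(η,v) + β(ξ+σ,z))} Φ(v,ξ) r(v,z)` over `(ξ,(v,z))`. -/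
def oscIntegral [MeasureSpace V] (β : V →L[ℝ] V →L[ℝ] ℝ) (Φ r : V × V → ℂ) (η σ : V) : ℂ :=
  ∫ p : V × (V × V), Complex.exp (Complex.I * ((β η p.2.1 + β (p.1 + σ) p.2.2 : ℝ) : ℂ)) *
    (Φ (p.2.1, p.1) * r p.2)

/-- A smooth amplitude supported in the ball of radius `2` around `c`, with derivatives up to order
`n` bounded by `Q`. -/
structure IsLocalAmplitude (n : ℕ) (c : V × V) (Q : ℝ) (r : V × V → ℂ) : Prop where
  smooth : ContDiff ℝ ∞ r
  support : ∀ w, r w ≠ 0 → ‖w - c‖ ≤ 2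
  bound : ∀ k ≤ n, ∀ w, ‖iteratedFDeriv ℝ k r w‖ ≤ Q

/-- A symbol with the `k`-th derivative bounded by `D k * (1 + ‖X‖) ^ p`. -/
structure IsSymbol {E : Type*} [NormedAddCommGroup E] [NormedSpace ℝ E] (p : ℕ) (D : ℕ → ℝ)
    (Φ : E → ℂ) : Prop where
  smooth : ContDiff ℝ ∞ Φ
  bound : ∀ k X, ‖iteratedFDeriv ℝ k Φ X‖ ≤ D k * (1 + ‖X‖) ^ p

theorem IsLocalAmplitude.nonneg {n : ℕ} {c : V × V} {Q : ℝ} {r : V × V → ℂ}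
    (h : IsLocalAmplitude n c Q r) : 0 ≤ Q :=
  (norm_nonneg _).trans (h.bound 0 (Nat.zero_le _) 0)

theorem IsLocalAmplitude.tsupport_subset {n : ℕ} {c : V × V} {Q : ℝ} {r : V × V → ℂ}
    (h : IsLocalAmplitude n c Q r) : tsupport r ⊆ Metric.closedBall c 2 := by
  refine closure_minimal (fun w hw => ?_) Metric.isClosed_closedBall
  rw [Metric.mem_closedBall, dist_eq_norm]
  exact h.support w hw

theorem IsLocalAmplitude.hasCompactSupport [FiniteDimensional ℝ V] {n : ℕ} {c : V × V} {Q : ℝ}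
    {r : V × V → ℂ} (h : IsLocalAmplitude n c Q r) : HasCompactSupport r :=
  (isCompact_closedBall c 2).of_isClosed_subset (isClosed_tsupport r) h.tsupport_subset

theorem IsSymbol.fderiv_apply {p : ℕ} {D : ℕ → ℝ} {Φ : V × V → ℂ} (h : IsSymbol p D Φ)
    {u : V × V} (hu : ‖u‖ ≤ 1) : IsSymbol p (fun k => D (k + 1)) fun X => fderiv ℝ Φ X u where
  smooth := h.smooth.fderiv_apply_const_infty u
  bound k X := by
    refine (norm_iteratedFDeriv_fderiv_apply_le h.smooth u X k).trans ?_
    exact (mul_le_of_le_one_left (norm_nonneg _) hu).trans (h.bound (k + 1) X)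

/-- Multiplying an amplitude by a linear function vanishing at its centre. -/
theorem IsLocalAmplitude.linear_mul {n : ℕ} {c : V × V} {Q : ℝ} {r : V × V → ℂ}
    (h : IsLocalAmplitude n c Q r) (l : V × V →L[ℝ] ℝ) {K : ℝ} (hK : ‖l‖ ≤ K) :
    IsLocalAmplitude n c (2 ^ n * (2 * K) * Q) fun w => (l (w - c) : ℂ) * r w := by
  have hK0 : 0 ≤ K := (norm_nonneg _).trans hK
  have hl : ContDiff ℝ ∞ fun w => (l (w - c) : ℂ) :=
    Complex.ofRealCLM.contDiff.comp (l.contDiff.comp (contDiff_id.sub contDiff_const))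
  refine ⟨hl.mul h.smooth, fun w hw => h.support w (right_ne_zero_of_mul hw), fun k hk w => ?_⟩
  by_cases hw : w ∈ tsupport r
  · have hwc : ‖w - c‖ ≤ 2 := by
      simpa [dist_eq_norm] using h.tsupport_subset hw
    refine norm_iteratedFDeriv_mul_le_of_bounds hl h.smooth (fun i _ => ?_)
      (fun i hi => h.bound i hi w) hk
    rcases i with _ | i
    · rw [norm_iteratedFDeriv_zero, Complex.norm_real]
      refine (l.le_opNorm _).trans ?_
      rw [mul_comm]
      gcongr
    · have hfd : fderiv ℝ (fun w => (l (w - c) : ℂ)) = fun _ => Complex.ofRealCLM.comp l := by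
        funext y
        have h1 : HasFDerivAt (fun w => l (w - c)) l y := by
          simpa using l.hasFDerivAt (x := y)
        exact (Complex.ofRealCLM.hasFDerivAt.comp y h1).fderiv
      have hle : ‖Complex.ofRealCLM.comp l‖ ≤ K := by
        refine ContinuousLinearMap.opNorm_le_bound _ hK0 fun x => ?_
        simpa using (l.le_opNorm x).trans (by gcongr)
      rw [← norm_iteratedFDeriv_fderiv, hfd]
      rcases i with _ | i
      · rw [norm_iteratedFDeriv_zero]; linarith
      · rw [iteratedFDeriv_const_of_ne (Nat.succ_ne_zero i)]
        simpa using by positivity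
  · have hw' : w ∉ tsupport (fun w => (l (w - c) : ℂ) * r w) :=
      fun hh => hw (closure_mono (Function.support_mul_subset_right _ _) hh)
    have h0 : iteratedFDeriv ℝ k (fun w => (l (w - c) : ℂ) * r w) w = 0 := by
      by_contra hne
      exact hw' (support_iteratedFDeriv_subset k hne)
    rw [h0, norm_zero]
    have := h.nonneg
    positivity

omit [NormedSpace ℝ V] in
theorem hasCompactSupport_symbol_mul {Φ r : V × V → ℂ} (hΦ : HasCompactSupport Φ)
    (hr : HasCompactSupport r) :
    HasCompactSupport fun p : V × (V × V) => Φ (p.2.1, p.1) * r p.2 := by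
  refine HasCompactSupport.intro
    ((hΦ.isCompact.image continuous_snd).prod hr.isCompact) fun p hp => ?_
  by_contra hne
  refine hp ⟨⟨_, subset_tsupport Φ (left_ne_zero_of_mul hne), rfl⟩,
    subset_tsupport r (right_ne_zero_of_mul hne)⟩

theorem contDiff_symbol_mul {Φ r : V × V → ℂ} (hΦ : ContDiff ℝ ∞ Φ) (hr : ContDiff ℝ ∞ r) :
    ContDiff ℝ ∞ fun p : V × (V × V) => Φ (p.2.1, p.1) * r p.2 :=
  (hΦ.comp (contDiff_snd.fst.prodMk contDiff_fst)).mul (hr.comp contDiff_snd)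

theorem contDiff_oscPhase (β : V →L[ℝ] V →L[ℝ] ℝ) (η σ : V) :
    ContDiff ℝ ∞ fun p : V × (V × V) => β η p.2.1 + β (p.1 + σ) p.2.2 := by
  have h1 : ContDiff ℝ ∞ fun p : V × (V × V) => β (p.1 + σ) :=
    β.contDiff.comp (contDiff_fst.add contDiff_const)
  exact ((β η).contDiff.comp contDiff_snd.fst).add (h1.clm_apply contDiff_snd.snd)

end Oscillatory

section Oscillatory

variable {V : Type*} [NormedAddCommGroup V] [NormedSpace ℝ V]
variable [FiniteDimensional ℝ V] [MeasureSpace V] [BorelSpace V]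
  [(volume : Measure V).IsAddHaarMeasure]

instance isAddHaarMeasure_volume_prod {E F : Type*} [NormedAddCommGroup E] [NormedSpace ℝ E]
    [FiniteDimensional ℝ E] [MeasureSpace E] [BorelSpace E] [(volume : Measure E).IsAddHaarMeasure]
    [NormedAddCommGroup F] [NormedSpace ℝ F] [FiniteDimensional ℝ F] [MeasureSpace F]
    [BorelSpace F] [(volume : Measure F).IsAddHaarMeasure] :
    (volume : Measure (E × F)).IsAddHaarMeasure :=
  inferInstanceAs (((volume : Measure E).prod (volume : Measure F)).IsAddHaarMeasure)

theorem integrable_oscIntegrand (β : V →L[ℝ] V →L[ℝ] ℝ) {Φ r : V × V → ℂ} (η σ : V)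
    (hΦ : ContDiff ℝ ∞ Φ) (hΦc : HasCompactSupport Φ) (hr : ContDiff ℝ ∞ r)
    (hrc : HasCompactSupport r) :
    Integrable fun p : V × (V × V) =>
      Complex.exp (Complex.I * ((β η p.2.1 + β (p.1 + σ) p.2.2 : ℝ) : ℂ)) *
      (Φ (p.2.1, p.1) * r p.2) :=
  ((contDiff_cexp_I_mul (contDiff_oscPhase β η σ)).continuous.mul
    (contDiff_symbol_mul hΦ hr).continuous).integrable_of_hasCompactSupport
    (hasCompactSupport_symbol_mul hΦc hrc).mul_left

theorem integral_norm_iteratedFDeriv_le_of_tsupport_subset {f : V → ℂ} {c : V} {R B : ℝ} {k : ℕ}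
    (hf : tsupport f ⊆ Metric.closedBall c R)
    (hB : ∀ w ∈ Metric.closedBall c R, ‖iteratedFDeriv ℝ k f w‖ ≤ B) :
    ∫ w, ‖iteratedFDeriv ℝ k f w‖ ≤ volume.real (Metric.closedBall (0 : V) R) * B := by
  have hzero : ∀ w, w ∉ Metric.closedBall c R → ‖iteratedFDeriv ℝ k f w‖ = 0 := by
    intro w hw
    rw [norm_eq_zero]
    by_contra hne
    exact hw (hf (support_iteratedFDeriv_subset k hne))
  rw [← setIntegral_eq_integral_of_forall_compl_eq_zero hzero]
  have h := norm_setIntegral_le_of_norm_le_const (μ := volume)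
    (f := fun w => ‖iteratedFDeriv ℝ k f w‖) (s := Metric.closedBall c R) (C := B)
    (isCompact_closedBall c R).measure_lt_top (fun w hw => by simpa using hB w hw)
  refine (Real.le_norm_self _).trans (h.trans_eq ?_)
  rw [mul_comm, Measure.real, Measure.real, Measure.addHaar_closedBall_center]

/-- Bounds on the frozen-frequency integral of `oscIntegral`. -/
theorem norm_frozen_oscIntegral_le {β : V →L[ℝ] V →L[ℝ] ℝ}
    (hβ : ∀ x, ∃ u, ‖u‖ ≤ 1 ∧ β x u = ‖x‖) {p N : ℕ} {Φ r : V × V → ℂ} {η σ ξ : V} {c : V × V}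
    {S Q : ℝ} (hS : 0 ≤ S) (hΦ : ContDiff ℝ ∞ Φ)
    (hΦb : ∀ k ≤ 2 * N, ∀ X, ‖iteratedFDeriv ℝ k Φ X‖ ≤ S * (1 + ‖X‖) ^ p)
    (hr : IsLocalAmplitude (2 * N) c Q r) :
    (1 + ‖η‖) ^ N * (1 + ‖ξ + σ‖) ^ N *
      ‖∫ w : V × V, Complex.exp (Complex.I * ((β η w.1 + β (ξ + σ) w.2 : ℝ) : ℂ)) *
        (Φ (w.1, ξ) * r w)‖
      ≤ 4 * 2 ^ (2 * N) * (2 ^ (2 * N) * 3 ^ p * volume.real (Metric.closedBall (0 : V × V) 2) *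
        S * Q * (1 + ‖c‖) ^ p * (1 + ‖ξ‖) ^ p) := by
  have hQ := hr.nonneg
  set l : V × V →L[ℝ] ℝ := (β η).comp (ContinuousLinearMap.fst ℝ V V)
    + (β (ξ + σ)).comp (ContinuousLinearMap.snd ℝ V V) with hl
  have hlx : ∀ w : V × V, β η w.1 + β (ξ + σ) w.2 = l w := fun w => rfl
  set L : V × V →L[ℝ] V × V := (ContinuousLinearMap.inl ℝ V V).comp
    (ContinuousLinearMap.fst ℝ V V) with hL
  have hL1 : ‖L‖ ≤ 1 := by
    refine ContinuousLinearMap.opNorm_le_bound _ zero_le_one fun w => ?_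
    simp [hL, Prod.norm_def]
  have hΦL : ∀ w : V × V, Φ (w.1, ξ) = Φ (L w + (0, ξ)) := fun w => by simp [hL]
  set f : V × V → ℂ := fun w => Φ (w.1, ξ) * r w with hf
  have hΦs : ContDiff ℝ ∞ fun w : V × V => Φ (w.1, ξ) :=
    hΦ.comp (contDiff_fst.prodMk contDiff_const)
  have hfs : ContDiff ℝ ∞ f := hΦs.mul hr.smooth
  have hfc : HasCompactSupport f := hr.hasCompactSupport.mul_left
  have hft : tsupport f ⊆ Metric.closedBall c 2 :=
    (closure_mono (Function.support_mul_subset_right _ _)).trans hr.tsupport_subset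
  set B : ℝ := 2 ^ (2 * N) * 3 ^ p * S * Q * (1 + ‖c‖) ^ p * (1 + ‖ξ‖) ^ p with hB
  have hpt : ∀ k ≤ 2 * N, ∀ w ∈ Metric.closedBall c 2, ‖iteratedFDeriv ℝ k f w‖ ≤ B := by
    intro k hk w hw
    have hwn : 1 + ‖(w.1, ξ)‖ ≤ 3 * (1 + ‖c‖) * (1 + ‖ξ‖) := by
      rw [Metric.mem_closedBall, dist_eq_norm] at hw
      have h1 : ‖w‖ ≤ ‖c‖ + 2 := by
        have := norm_le_norm_add_norm_sub' w c
        linarith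
      have h2 : ‖(w.1, ξ)‖ ≤ ‖w‖ + ‖ξ‖ := by
        refine max_le ((norm_fst_le w).trans ?_) ?_
        · linarith [norm_nonneg ξ]
        · simp
      nlinarith [norm_nonneg c, norm_nonneg ξ, mul_nonneg (norm_nonneg c) (norm_nonneg ξ)]
    have h := norm_iteratedFDeriv_mul_le_of_bounds (n := 2 * N) (x := w) hΦs hr.smooth
      (A := S * (3 * (1 + ‖c‖) * (1 + ‖ξ‖)) ^ p) (B := Q) (fun i hi => ?_)
      (fun i hi => hr.bound i hi w) hk
    · refine h.trans_eq ?_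
      rw [hB, mul_pow, mul_pow]; ring
    · simp only [hΦL]
      refine (norm_iteratedFDeriv_comp_affine_le hΦ L hL1 (0, ξ) i w).trans ?_
      rw [show L w + (0, ξ) = (w.1, ξ) by simp [hL]]
      refine (hΦb i hi _).trans ?_
      gcongr
  have hint : ∀ k ≤ 2 * N, ∫ w, ‖iteratedFDeriv ℝ k f w‖
      ≤ volume.real (Metric.closedBall (0 : V × V) 2) * B :=
    fun k hk => integral_norm_iteratedFDeriv_le_of_tsupport_subset hft (hpt k hk)
  simp only [hlx]
  obtain ⟨u₁, hu₁, hu₁'⟩ := hβ η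
  obtain ⟨u₂, hu₂, hu₂'⟩ := hβ (ξ + σ)
  have e0 := (pow_abs_mul_norm_integral_cexp_mul_le l (u := 0) (by simp) 0 hfs hfc).trans
    (hint 0 (Nat.zero_le _))
  have e1 := (pow_abs_mul_norm_integral_cexp_mul_le l (u := (u₁, 0)) (by simpa [Prod.norm_def])
    (2 * N) hfs hfc).trans (hint _ le_rfl)
  have e2 := (pow_abs_mul_norm_integral_cexp_mul_le l (u := (0, u₂)) (by simpa [Prod.norm_def])
    (2 * N) hfs hfc).trans (hint _ le_rfl)
  rw [show l (u₁, 0) = ‖η‖ by simp [hl, hu₁'], abs_norm] at e1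
  rw [show l (0, u₂) = ‖ξ + σ‖ by simp [hl, hu₂', -map_add], abs_norm] at e2
  rw [pow_zero, one_mul] at e0
  refine (one_add_pow_mul_one_add_pow_le (norm_nonneg _) (norm_nonneg _) (norm_nonneg _) N
    e0 e1 e2).trans_eq ?_
  rw [hB]; ring

theorem exists_oscIntegral_bound {β : V →L[ℝ] V →L[ℝ] ℝ}
    (hβ : ∀ x, ∃ u, ‖u‖ ≤ 1 ∧ β x u = ‖x‖) {p N : ℕ} (hN : p + Module.finrank ℝ V < N) :
    ∃ C : ℝ, 0 ≤ C ∧ ∀ (Φ r : V × V → ℂ) (η σ : V) (c : V × V) (S Q : ℝ), 0 ≤ S →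
      ContDiff ℝ ∞ Φ → HasCompactSupport Φ →
      (∀ k ≤ 2 * N, ∀ X, ‖iteratedFDeriv ℝ k Φ X‖ ≤ S * (1 + ‖X‖) ^ p) →
      IsLocalAmplitude (2 * N) c Q r →
      (1 + ‖η‖) ^ N * ‖oscIntegral β Φ r η σ‖ ≤ C * S * Q * (1 + ‖c‖) ^ p * (1 + ‖σ‖) ^ p := by
  set K : ℝ := 4 * 2 ^ (2 * N) * (2 ^ (2 * N) * 3 ^ p *
    volume.real (Metric.closedBall (0 : V × V) 2)) with hK
  have hdecay : Integrable fun ξ : V => ((1 + ‖ξ‖) ^ (N - p))⁻¹ := by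
    have h := integrable_one_add_norm (E := V) (μ := volume) (r := ((N - p : ℕ) : ℝ))
      (by exact_mod_cast (by omega))
    refine h.congr (Eventually.of_forall fun ξ => ?_)
    simp only
    rw [Real.rpow_neg (by positivity), Real.rpow_natCast]
  refine ⟨K * ∫ ξ : V, ((1 + ‖ξ‖) ^ (N - p))⁻¹, ?_, ?_⟩
  · refine mul_nonneg (by positivity) (integral_nonneg fun ξ => by positivity)
  intro Φ r η σ c S Q hS hΦ hΦc hΦb hr
  have hQ := hr.nonneg
  unfold oscIntegral
  have hintg := integrable_oscIntegrand β η σ hΦ hΦc hr.smooth hr.hasCompactSupport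
  rw [Measure.volume_eq_prod, integral_prod _ hintg]
  have hpos : (0 : ℝ) < (1 + ‖η‖) ^ N := by positivity
  rw [mul_comm, ← le_div_iff₀ hpos]
  refine (norm_integral_le_of_norm_le
    ((hdecay.comp_add_right σ).const_mul
      (K * S * Q * (1 + ‖c‖) ^ p * (1 + ‖σ‖) ^ p / (1 + ‖η‖) ^ N))
    (Eventually.of_forall fun ξ => ?_)).trans_eq ?_
  · have h := norm_frozen_oscIntegral_le (η := η) (σ := σ) (ξ := ξ) hβ hS hΦ hΦb hr
    simp only at h ⊢
    have hξ : (1 + ‖ξ‖) ≤ (1 + ‖σ‖) * (1 + ‖ξ + σ‖) := by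
      have h1 : ‖ξ‖ ≤ ‖ξ + σ‖ + ‖σ‖ := by simpa using norm_sub_le (ξ + σ) σ
      nlinarith [mul_nonneg (norm_nonneg (ξ + σ)) (norm_nonneg σ)]
    have hsplit : (1 + ‖ξ + σ‖) ^ N = (1 + ‖ξ + σ‖) ^ (N - p) * (1 + ‖ξ + σ‖) ^ p := by
      rw [← pow_add, Nat.sub_add_cancel (by omega)]
    have hp' : (0 : ℝ) < (1 + ‖ξ + σ‖) ^ p := by positivity
    have hNp : (0 : ℝ) < (1 + ‖ξ + σ‖) ^ (N - p) := by positivity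
    rw [div_mul_eq_mul_div, ← div_eq_mul_inv, le_div_iff₀ hpos, le_div_iff₀ hNp]
    refine le_of_mul_le_mul_right ?_ hp'
    calc _ = _ := ?_
      _ ≤ _ := h
      _ ≤ 4 * 2 ^ (2 * N) * (2 ^ (2 * N) * 3 ^ p *
            volume.real (Metric.closedBall (0 : V × V) 2) *
            S * Q * (1 + ‖c‖) ^ p * ((1 + ‖σ‖) * (1 + ‖ξ + σ‖)) ^ p) := by gcongr
      _ = _ := ?_
    · rw [hsplit]; ring
    · rw [hK, mul_pow]; ring
  · rw [integral_const_mul, integral_add_right_eq_self (fun ξ : V => ((1 + ‖ξ‖) ^ (N - p))⁻¹)]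
    ring

end Oscillatory

section Oscillatory

variable {V : Type*} [NormedAddCommGroup V] [NormedSpace ℝ V]
variable [FiniteDimensional ℝ V] [MeasureSpace V] [BorelSpace V]
  [(volume : Measure V).IsAddHaarMeasure]

/-- Integration by parts in the frequency variable. -/
theorem oscIntegral_linear_mul (β : V →L[ℝ] V →L[ℝ] ℝ) {Φ r : V × V → ℂ} (η σ u : V)
    (hΦ : ContDiff ℝ ∞ Φ) (hΦc : HasCompactSupport Φ) (hr : ContDiff ℝ ∞ r)
    (hrc : HasCompactSupport r) :
    oscIntegral β Φ (fun w => (β u w.2 : ℂ) * r w) η σ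
      = Complex.I * oscIntegral β (fun X => fderiv ℝ Φ X (0, u)) r η σ := by
  set θ : V × (V × V) → ℝ := fun p => β η p.2.1 + β (p.1 + σ) p.2.2 with hθ
  have hθs : ContDiff ℝ ∞ θ := contDiff_oscPhase β η σ
  have hfd : ∀ p : V × (V × V), fderiv ℝ (fun p : V × (V × V) => Φ (p.2.1, p.1) * r p.2) p
      (u, (0, 0)) = fderiv ℝ Φ (p.2.1, p.1) (0, u) * r p.2 := by
    intro p
    have h1 : HasFDerivAt (fun p : V × (V × V) => (p.2.1, p.1))
        (((ContinuousLinearMap.fst ℝ V V).comp (ContinuousLinearMap.snd ℝ V (V × V))).prod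
          (ContinuousLinearMap.fst ℝ V (V × V))) p :=
      (((ContinuousLinearMap.fst ℝ V V).comp (ContinuousLinearMap.snd ℝ V (V × V))).prod
          (ContinuousLinearMap.fst ℝ V (V × V))).hasFDerivAt
    have h2 := ((hΦ.differentiable (by simp)) (p.2.1, p.1)).hasFDerivAt.comp p h1
    have h3 := ((hr.differentiable (by simp)) p.2).hasFDerivAt.comp p
      (ContinuousLinearMap.snd ℝ V (V × V)).hasFDerivAt
    have h4 := (h2.mul h3).fderiv
    have h5 : fderiv ℝ (fun p : V × (V × V) => Φ (p.2.1, p.1) * r p.2) p = _ := h4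
    rw [h5]
    have h6 : fderiv ℝ r p.2 (0, 0) = 0 := map_zero _
    simp [h6, mul_comm]
  have hθd : ∀ p : V × (V × V), fderiv ℝ θ p (u, (0, 0)) = β u p.2.2 := by
    intro p
    have h1 : HasFDerivAt (fun p : V × (V × V) => β η p.2.1)
        ((β η).comp ((ContinuousLinearMap.fst ℝ V V).comp (ContinuousLinearMap.snd ℝ V (V × V))))
        p := ((β η).comp ((ContinuousLinearMap.fst ℝ V V).comp
          (ContinuousLinearMap.snd ℝ V (V × V)))).hasFDerivAt
    have h2 : HasFDerivAt (fun p : V × (V × V) => β (p.1 + σ))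
        (β.comp (ContinuousLinearMap.fst ℝ V (V × V))) p := by
      have := (β.comp (ContinuousLinearMap.fst ℝ V (V × V))).hasFDerivAt (x := p)
      simpa using this.add_const (β σ)
    have h3 := h2.clm_apply ((ContinuousLinearMap.snd ℝ V V).comp
      (ContinuousLinearMap.snd ℝ V (V × V))).hasFDerivAt
    have h4 := (h1.add h3).fderiv
    have h5 : fderiv ℝ θ p = _ := h4
    rw [h5]
    simp
  have hibp := integral_mul_fderiv_of_hasCompactSupport (contDiff_cexp_I_mul hθs)
    (contDiff_symbol_mul hΦ hr) (hasCompactSupport_symbol_mul hΦc hrc) (u, (0, 0))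
  simp only [hfd, fderiv_cexp_I_mul (hθs.differentiable (by simp)), hθd] at hibp
  have hb : oscIntegral β (fun X => fderiv ℝ Φ X (0, u)) r η σ
      = -(Complex.I * oscIntegral β Φ (fun w => (β u w.2 : ℂ) * r w) η σ) := by
    unfold oscIntegral
    rw [← integral_const_mul]
    refine hibp.trans ?_
    congr 2
    funext p
    simp only [hθ]
    ring
  rw [hb, mul_neg, ← mul_assoc, Complex.I_mul_I]
  ring

/-- Commuting the linear function `β u` past the amplitude. -/
theorem oscIntegral_sub_linear_mul (β : V →L[ℝ] V →L[ℝ] ℝ) {Φ r : V × V → ℂ} (η σ u : V)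
    (c : V × V) (hΦ : ContDiff ℝ ∞ Φ) (hΦc : HasCompactSupport Φ) (hr : ContDiff ℝ ∞ r)
    (hrc : HasCompactSupport r) :
    (β u c.2 : ℂ) * oscIntegral β Φ r η σ
      = oscIntegral β Φ (fun w => (β u w.2 : ℂ) * r w) η σ
        - oscIntegral β Φ (fun w => (((β u).comp (ContinuousLinearMap.snd ℝ V V)) (w - c) : ℂ)
          * r w) η σ := by
  unfold oscIntegral
  have h1 : ContDiff ℝ ∞ fun w : V × V => (β u w.2 : ℂ) * r w :=
    (Complex.ofRealCLM.contDiff.comp ((β u).contDiff.comp contDiff_snd)).mul hr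
  have h2 : ContDiff ℝ ∞ fun w : V × V =>
      (((β u).comp (ContinuousLinearMap.snd ℝ V V)) (w - c) : ℂ) * r w :=
    (Complex.ofRealCLM.contDiff.comp (((β u).comp
      (ContinuousLinearMap.snd ℝ V V)).contDiff.comp (contDiff_id.sub contDiff_const))).mul hr
  rw [← integral_sub (integrable_oscIntegrand β η σ hΦ hΦc h1 hrc.mul_left)
    (integrable_oscIntegrand β η σ hΦ hΦc h2 hrc.mul_left), ← integral_const_mul]
  congr 1
  funext p
  simp only [ContinuousLinearMap.comp_apply, ContinuousLinearMap.coe_snd', map_sub,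
    Complex.ofReal_sub]
  ring

theorem exists_oscIntegral_linear_pow_bound {β : V →L[ℝ] V →L[ℝ] ℝ}
    (hβ : ∀ x, ∃ u, ‖u‖ ≤ 1 ∧ β x u = ‖x‖) {p N : ℕ} (hN : p + Module.finrank ℝ V < N)
    (m : ℕ) : ∀ D : ℕ → ℝ, ∃ C : ℝ, 0 ≤ C ∧ ∀ (Φ r : V × V → ℂ) (η σ u : V) (c : V × V) (Q : ℝ),
      ‖u‖ ≤ 1 → IsSymbol p D Φ → HasCompactSupport Φ → IsLocalAmplitude (2 * N) c Q r →
      |β u c.2| ^ m * ((1 + ‖η‖) ^ N * ‖oscIntegral β Φ r η σ‖)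
        ≤ C * Q * (1 + ‖c‖) ^ p * (1 + ‖σ‖) ^ p := by
  induction m with
  | zero =>
    intro D
    obtain ⟨C, hC, h⟩ := exists_oscIntegral_bound hβ hN
    refine ⟨C * ∑ k ∈ Finset.range (2 * N + 1), |D k|, by positivity, ?_⟩
    intro Φ r η σ u c Q _ hΦ hΦc hr
    rw [pow_zero, one_mul]
    refine h Φ r η σ c _ Q (by positivity) hΦ.smooth hΦc (fun k hk X => ?_) hr
    refine (hΦ.bound k X).trans ?_
    gcongr
    refine (le_abs_self _).trans ?_
    exact Finset.single_le_sum (f := fun k => |D k|) (fun i _ => abs_nonneg _)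
      (Finset.mem_range.2 (by omega))
  | succ m ih =>
    intro D
    obtain ⟨C₁, hC₁, h₁⟩ := ih fun k => D (k + 1)
    obtain ⟨C₂, hC₂, h₂⟩ := ih D
    refine ⟨C₁ + C₂ * (2 ^ (2 * N) * (2 * ‖β‖)), by positivity, ?_⟩
    intro Φ r η σ u c Q hu hΦ hΦc hr
    have hl : ‖(β u).comp (ContinuousLinearMap.snd ℝ V V)‖ ≤ ‖β‖ := by
      refine ContinuousLinearMap.opNorm_le_bound _ (norm_nonneg β) fun w => ?_
      refine ((β u).le_opNorm w.2).trans ?_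
      have h1 : ‖β u‖ ≤ ‖β‖ := by
        refine (β.le_opNorm u).trans ?_
        exact mul_le_of_le_one_right (norm_nonneg _) hu
      gcongr
      exact norm_snd_le w
    have e₁ := h₁ (fun X => fderiv ℝ Φ X (0, u)) r η σ u c Q hu
      (hΦ.fderiv_apply (by simpa [Prod.norm_def])) (hΦc.fderiv_apply ℝ (0, u)) hr
    have e₂ := h₂ Φ _ η σ u c _ hu hΦ hΦc (hr.linear_mul _ hl)
    have hsplit := oscIntegral_sub_linear_mul β η σ u c hΦ.smooth hΦc hr.smooth
      hr.hasCompactSupport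
    rw [oscIntegral_linear_mul β η σ u hΦ.smooth hΦc hr.smooth hr.hasCompactSupport] at hsplit
    have hnorm : |β u c.2| * ‖oscIntegral β Φ r η σ‖
        ≤ ‖oscIntegral β (fun X => fderiv ℝ Φ X (0, u)) r η σ‖
        + ‖oscIntegral β Φ (fun w => (((β u).comp (ContinuousLinearMap.snd ℝ V V)) (w - c) : ℂ)
          * r w) η σ‖ := by
      have h3 := congrArg norm hsplit
      rw [norm_mul, Complex.norm_real, Real.norm_eq_abs] at h3
      rw [h3]
      refine (norm_sub_le _ _).trans_eq ?_
      rw [norm_mul, Complex.norm_I, one_mul]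
    calc |β u c.2| ^ (m + 1) * ((1 + ‖η‖) ^ N * ‖oscIntegral β Φ r η σ‖)
        = |β u c.2| ^ m * ((1 + ‖η‖) ^ N * (|β u c.2| * ‖oscIntegral β Φ r η σ‖)) := by ring
      _ ≤ |β u c.2| ^ m * ((1 + ‖η‖) ^ N * (_ + _)) := by gcongr
      _ = |β u c.2| ^ m * ((1 + ‖η‖) ^ N * _) + |β u c.2| ^ m * ((1 + ‖η‖) ^ N * _) := by ring
      _ ≤ _ := add_le_add e₁ e₂
      _ = _ := by ring

/-- Decay of `oscIntegral` in `η` and in the second component of the centre of the amplitude. -/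
theorem exists_oscIntegral_decay {β : V →L[ℝ] V →L[ℝ] ℝ}
    (hβ : ∀ x, ∃ u, ‖u‖ ≤ 1 ∧ β x u = ‖x‖) (hβ' : ∀ x, ∃ u, ‖u‖ ≤ 1 ∧ β u x = ‖x‖) {p N : ℕ}
    (hN : p + Module.finrank ℝ V < N) (m : ℕ) (D : ℕ → ℝ) :
    ∃ C : ℝ, 0 ≤ C ∧ ∀ (Φ r : V × V → ℂ) (η σ : V) (c : V × V) (Q : ℝ),
      IsSymbol p D Φ → HasCompactSupport Φ → IsLocalAmplitude (2 * N) c Q r →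
      (1 + ‖c.2‖) ^ m * (1 + ‖η‖) ^ N * ‖oscIntegral β Φ r η σ‖
        ≤ C * Q * (1 + ‖c‖) ^ p * (1 + ‖σ‖) ^ p := by
  obtain ⟨C₀, hC₀, h₀⟩ := exists_oscIntegral_linear_pow_bound hβ hN 0 D
  obtain ⟨C₁, hC₁, h₁⟩ := exists_oscIntegral_linear_pow_bound hβ hN m D
  refine ⟨2 ^ m * (C₀ + C₁), by positivity, ?_⟩
  intro Φ r η σ c Q hΦ hΦc hr
  obtain ⟨u, hu, hu'⟩ := hβ' c.2
  have e₀ := h₀ Φ r η σ u c Q hu hΦ hΦc hr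
  have e₁ := h₁ Φ r η σ u c Q hu hΦ hΦc hr
  rw [hu', abs_norm] at e₀ e₁
  have h3 : (1 + ‖c.2‖) ^ m ≤ 2 ^ m * (1 + ‖c.2‖ ^ m) := by
    have h4 := add_pow_le (zero_le_one (α := ℝ)) (norm_nonneg c.2) m
    rw [one_pow] at h4
    refine h4.trans ?_
    gcongr
    · norm_num
    · exact Nat.sub_le _ _
  calc (1 + ‖c.2‖) ^ m * (1 + ‖η‖) ^ N * ‖oscIntegral β Φ r η σ‖
      ≤ 2 ^ m * (1 + ‖c.2‖ ^ m) * (1 + ‖η‖) ^ N * ‖oscIntegral β Φ r η σ‖ := by gcongr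
    _ = 2 ^ m * (‖c.2‖ ^ 0 * ((1 + ‖η‖) ^ N * ‖oscIntegral β Φ r η σ‖)
        + ‖c.2‖ ^ m * ((1 + ‖η‖) ^ N * ‖oscIntegral β Φ r η σ‖)) := by ring
    _ ≤ 2 ^ m * (C₀ * Q * (1 + ‖c‖) ^ p * (1 + ‖σ‖) ^ p
        + C₁ * Q * (1 + ‖c‖) ^ p * (1 + ‖σ‖) ^ p) := by gcongr
    _ = _ := by ring

end Oscillatory

open Function in
/-- Integrals over `[0, 1]` depending on a parameter inherit temperate growth. -/
theorem contDiff_intervalIntegral_param (n : ℕ) : ∀ {E F : Type} [NormedAddCommGroup E]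
    [NormedSpace ℝ E] [NormedAddCommGroup F] [NormedSpace ℝ F] {f : ℝ × E → F},
    f.HasTemperateGrowth → ContDiff ℝ n (fun x => ∫ s in (0 : ℝ)..1, f (s, x)) ∧
      ∃ (k : ℕ) (C : ℝ), ∀ x,
        ‖iteratedFDeriv ℝ n (fun x => ∫ s in (0 : ℝ)..1, f (s, x)) x‖ ≤ C * (1 + ‖x‖) ^ k := by
  have hpair : ∀ {E : Type} [NormedAddCommGroup E] (x : E) (s : ℝ), s ∈ Set.uIoc (0 : ℝ) 1 →
      1 + ‖(s, x)‖ ≤ 2 * (1 + ‖x‖) := by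
    intro E _ x s hs
    rw [Set.uIoc_of_le zero_le_one] at hs
    have : ‖(s, x)‖ ≤ 1 + ‖x‖ := by
      refine max_le ?_ (by simp)
      simp only [Real.norm_eq_abs, abs_of_pos hs.1]
      linarith [hs.2, norm_nonneg x]
    linarith [norm_nonneg x]
  induction n with
  | zero =>
    intro E F _ _ _ _ f hf
    obtain ⟨k, C, hC, h⟩ := hf.norm_iteratedFDeriv_le_uniform 0
    have h' : ∀ (x : E), ∀ s ∈ Set.uIoc (0 : ℝ) 1, ‖f (s, x)‖ ≤ C * (2 * (1 + ‖x‖)) ^ k := by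
      intro x s hs
      have h1 := h 0 le_rfl (s, x)
      rw [norm_iteratedFDeriv_zero] at h1
      refine h1.trans ?_
      gcongr
      exact hpair x s hs
    refine ⟨?_, k, C * 2 ^ k, fun x => ?_⟩
    · rw [Nat.cast_zero, contDiff_zero]
      have := hf.1.continuous
      exact intervalIntegral.continuous_parametric_intervalIntegral_of_continuous'
        (f := fun x s => f (s, x)) (by fun_prop) 0 1
    · rw [norm_iteratedFDeriv_zero]
      refine (intervalIntegral.norm_integral_le_of_norm_le_const (h' x)).trans_eq ?_
      rw [mul_pow]
      simp
      ring
  | succ n ih =>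
    intro E F _ _ _ _ f hf
    set R : (ℝ × E →L[ℝ] F) →L[ℝ] (E →L[ℝ] F) :=
      (ContinuousLinearMap.compL ℝ E (ℝ × E) F).flip (ContinuousLinearMap.inr ℝ ℝ E) with hR
    have hf' : (fderiv ℝ f).HasTemperateGrowth := by
      refine ⟨hf.1.fderiv_right (by simp), fun m => ?_⟩
      obtain ⟨k, C, h⟩ := hf.2 (m + 1)
      exact ⟨k, C, fun x => by rw [norm_iteratedFDeriv_fderiv]; exact h x⟩
    have hRf : (fun p => R (fderiv ℝ f p)).HasTemperateGrowth := R.hasTemperateGrowth.comp hf'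
    obtain ⟨hc, k, C, hk⟩ := ih hRf
    have hderiv : ∀ x, HasFDerivAt (fun x => ∫ s in (0 : ℝ)..1, f (s, x))
        (∫ s in (0 : ℝ)..1, R (fderiv ℝ f (s, x))) x := by
      intro x
      obtain ⟨k, C, hC, h⟩ := hRf.norm_iteratedFDeriv_le_uniform 0
      have hfc := hf.1.continuous
      have hRc := hRf.1.continuous
      refine intervalIntegral.hasFDerivAt_integral_of_dominated_of_fderiv_le
        (F := fun x s => f (s, x)) (F' := fun x s => R (fderiv ℝ f (s, x)))
        (s := Metric.ball x 1) (bound := fun _ => C * (2 * (1 + (‖x‖ + 1))) ^ k)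
        (Metric.ball_mem_nhds x one_pos) (Eventually.of_forall fun y => ?_) ?_ ?_ ?_ (by simp) ?_
      · exact (hfc.comp (by fun_prop : Continuous fun s : ℝ => (s, y))).aestronglyMeasurable
      · exact (hfc.comp (by fun_prop : Continuous fun s : ℝ => (s, x))).intervalIntegrable 0 1
      · exact (hRc.comp (by fun_prop : Continuous fun s : ℝ => (s, x))).aestronglyMeasurable
      · refine Eventually.of_forall fun s hs y hy => ?_
        have h1 := h 0 le_rfl (s, y)
        rw [norm_iteratedFDeriv_zero] at h1
        refine h1.trans ?_
        have h2 : ‖y‖ ≤ ‖x‖ + 1 := by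
          rw [Metric.mem_ball, dist_eq_norm] at hy
          have := norm_le_norm_add_norm_sub' y x
          linarith
        gcongr
        refine (hpair y s hs).trans ?_
        gcongr
      · refine Eventually.of_forall fun s _ y _ => ?_
        have h1 : HasFDerivAt (fun y : E => (s, y)) (ContinuousLinearMap.inr ℝ ℝ E) y :=
          hasFDerivAt_prodMk_right s y
        exact ((hf.1.differentiable (by simp)) (s, y)).hasFDerivAt.comp y h1
    have hfd : fderiv ℝ (fun x => ∫ s in (0 : ℝ)..1, f (s, x))
        = fun x => ∫ s in (0 : ℝ)..1, R (fderiv ℝ f (s, x)) := funext fun x => (hderiv x).fderiv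
    refine ⟨?_, k, C, fun x => ?_⟩
    · rw [Nat.cast_succ, contDiff_succ_iff_fderiv]
      refine ⟨fun x => (hderiv x).differentiableAt, by simp, ?_⟩
      rw [hfd]
      exact hc
    · rw [← norm_iteratedFDeriv_fderiv, hfd]
      exact hk x

theorem Function.HasTemperateGrowth.intervalIntegral_param {E F : Type} [NormedAddCommGroup E]
    [NormedSpace ℝ E] [NormedAddCommGroup F] [NormedSpace ℝ F] {f : ℝ × E → F}
    (hf : f.HasTemperateGrowth) :
    (fun x => ∫ s in (0 : ℝ)..1, f (s, x)).HasTemperateGrowth :=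
  ⟨contDiff_infty.2 fun n => (contDiff_intervalIntegral_param n hf).1,
    fun n => (contDiff_intervalIntegral_param n hf).2⟩

theorem Function.HasTemperateGrowth.prodMk {D E F : Type*} [NormedAddCommGroup D]
    [NormedSpace ℝ D] [NormedAddCommGroup E] [NormedSpace ℝ E] [NormedAddCommGroup F]
    [NormedSpace ℝ F] {f : D → E} {g : D → F} (hf : f.HasTemperateGrowth)
    (hg : g.HasTemperateGrowth) : (fun x => (f x, g x)).HasTemperateGrowth := by
  have h := ((ContinuousLinearMap.inl ℝ E F).hasTemperateGrowth.comp hf).add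
    ((ContinuousLinearMap.inr ℝ E F).hasTemperateGrowth.comp hg)
  convert h using 1
  funext x
  simp

theorem hasTemperateGrowth_cexp_I_mul :
    (fun t : ℝ => Complex.exp (Complex.I * (t : ℂ))).HasTemperateGrowth := by
  have hd : ∀ n : ℕ, iteratedDeriv n (fun t : ℝ => Complex.exp (Complex.I * (t : ℂ)))
      = fun t : ℝ => Complex.I ^ n * Complex.exp (Complex.I * (t : ℂ)) := by
    intro n
    induction n with
    | zero => simp
    | succ n ih =>
      rw [iteratedDeriv_succ, ih]
      funext t
      have h1 : HasDerivAt (fun t : ℝ => Complex.I * (t : ℂ)) Complex.I t := by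
        simpa using (Complex.ofRealCLM.hasDerivAt (x := t)).const_mul Complex.I
      rw [(h1.cexp.const_mul (Complex.I ^ n)).deriv]
      ring
  refine ⟨?_, fun n => ⟨0, 1, fun t => ?_⟩⟩
  · exact (contDiff_const.mul Complex.ofRealCLM.contDiff).cexp
  · rw [norm_iteratedFDeriv_eq_norm_iteratedDeriv, hd]
    simp [Complex.norm_exp]

section MagneticPhase

variable {d : ℕ}

theorem IsRegularMagneticField.hasTemperateGrowth {B : Fin d → Fin d → E1 d → ℝ}
    (hB : IsRegularMagneticField d B) (j k : Fin d) : (B j k).HasTemperateGrowth := by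
  refine ⟨hB.smooth j k, fun n => ?_⟩
  obtain ⟨C, hC⟩ := hB.derivBounded j k n
  exact ⟨0, C, fun x => by simpa using hC x⟩

theorem IsWindow.hasTemperateGrowth {g : E1 d → ℝ} (hg : IsWindow d g) : g.HasTemperateGrowth :=
  hg.compactSupport.hasTemperateGrowth hg.smooth

theorem IsRegularMagneticField.hasTemperateGrowth_magA {B : Fin d → Fin d → E1 d → ℝ}
    (hB : IsRegularMagneticField d B) (k : Fin d) :
    (fun x => magA d B 0 x k).HasTemperateGrowth := by
  unfold magA
  refine Function.HasTemperateGrowth.sum fun j _ => ?_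
  refine Function.HasTemperateGrowth.intervalIntegral_param
    (f := fun p : ℝ × E1 d => p.1 * (p.2 j - (0 : E1 d) j) * B j k (0 + p.1 • (p.2 - 0))) ?_
  have h1 : (fun p : ℝ × E1 d => p.1).HasTemperateGrowth :=
    (ContinuousLinearMap.fst ℝ ℝ (E1 d)).hasTemperateGrowth
  have h2 : (fun p : ℝ × E1 d => p.2).HasTemperateGrowth :=
    (ContinuousLinearMap.snd ℝ ℝ (E1 d)).hasTemperateGrowth
  have h3 : (fun p : ℝ × E1 d => p.2 j).HasTemperateGrowth :=
    (ContinuousLinearMap.proj (R := ℝ) (φ := fun _ : Fin d => ℝ) j).hasTemperateGrowth.comp h2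
  have h4 : (fun p : ℝ × E1 d => B j k (p.1 • p.2)).HasTemperateGrowth :=
    (hB.hasTemperateGrowth j k).comp (h1.fun_smul h2)
  simpa using (h1.fun_mul h3).fun_mul h4

theorem IsRegularMagneticField.hasTemperateGrowth_magPhi {B : Fin d → Fin d → E1 d → ℝ}
    (hB : IsRegularMagneticField d B) :
    (fun q : E1 d × E1 d => magPhi d B q.1 q.2).HasTemperateGrowth := by
  unfold magPhi
  refine Function.HasTemperateGrowth.sum fun k _ => ?_
  refine Function.HasTemperateGrowth.intervalIntegral_param
    (f := fun p : ℝ × (E1 d × E1 d) =>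
      magA d B 0 (p.2.2 + p.1 • (p.2.1 - p.2.2)) k * (p.2.1 k - p.2.2 k)) ?_
  have h1 : (fun p : ℝ × (E1 d × E1 d) => p.1).HasTemperateGrowth :=
    (ContinuousLinearMap.fst ℝ ℝ (E1 d × E1 d)).hasTemperateGrowth
  have h2 : (fun p : ℝ × (E1 d × E1 d) => p.2.1).HasTemperateGrowth :=
    ((ContinuousLinearMap.fst ℝ (E1 d) (E1 d)).comp
      (ContinuousLinearMap.snd ℝ ℝ (E1 d × E1 d))).hasTemperateGrowth
  have h3 : (fun p : ℝ × (E1 d × E1 d) => p.2.2).HasTemperateGrowth :=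
    ((ContinuousLinearMap.snd ℝ (E1 d) (E1 d)).comp
      (ContinuousLinearMap.snd ℝ ℝ (E1 d × E1 d))).hasTemperateGrowth
  have hp := (ContinuousLinearMap.proj (R := ℝ) (φ := fun _ : Fin d => ℝ) k).hasTemperateGrowth
  have h4 : (fun p : ℝ × (E1 d × E1 d) =>
      magA d B 0 (p.2.2 + p.1 • (p.2.1 - p.2.2)) k).HasTemperateGrowth :=
    (hB.hasTemperateGrowth_magA k).comp (h3.fun_add (h1.fun_smul (h2.fun_sub h3)))
  exact h4.fun_mul ((hp.comp h2).fun_sub (hp.comp h3))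

end MagneticPhase

/-- A linear change of variables multiplies all integrals by the same constant. -/
theorem exists_integral_comp_continuousLinearEquiv {X Y : Type*} [NormedAddCommGroup X]
    [NormedSpace ℝ X] [FiniteDimensional ℝ X] [MeasureSpace X] [BorelSpace X]
    [(volume : Measure X).IsAddHaarMeasure] [NormedAddCommGroup Y] [NormedSpace ℝ Y]
    [FiniteDimensional ℝ Y] [MeasureSpace Y] [BorelSpace Y]
    [(volume : Measure Y).IsAddHaarMeasure] (e : X ≃L[ℝ] Y) :
    ∃ κ : ℝ, 0 ≤ κ ∧ ∀ f : Y → ℂ, ∫ x, f (e x) = (κ : ℂ) * ∫ y, f y := by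
  have h := Measure.isAddLeftInvariant_eq_smul (Measure.map e (volume : Measure X))
    (volume : Measure Y)
  set κ := Measure.addHaarScalarFactor (Measure.map e (volume : Measure X)) (volume : Measure Y)
  refine ⟨κ, κ.2, fun f => ?_⟩
  have h1 : ∫ x, f (e x) = ∫ y, f y ∂(Measure.map e volume) :=
    (e.toHomeomorph.measurableEmbedding.integral_map f).symm
  rw [h1, h, integral_smul_nnreal_measure]
  rfl

/-- Slices of a function of temperate growth which are supported near a point depending linearly
on the parameter are local amplitudes. -/
theorem Function.HasTemperateGrowth.exists_isLocalAmplitude {V P : Type*} [NormedAddCommGroup V]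
    [NormedSpace ℝ V] [NormedAddCommGroup P] [NormedSpace ℝ P] {a : (V × V) × P → ℂ}
    (ha : a.HasTemperateGrowth) (c : P →L[ℝ] V × V)
    (hc : ∀ w q, a (w, q) ≠ 0 → ‖w - c q‖ ≤ 2) (n : ℕ) :
    ∃ (C : ℝ) (k : ℕ), 0 ≤ C ∧
      ∀ q, IsLocalAmplitude n (c q) (C * (1 + ‖q‖) ^ k) fun w => a (w, q) := by
  obtain ⟨k, C, hC, h⟩ := ha.norm_iteratedFDeriv_le_uniform n
  refine ⟨C * (3 + ‖c‖) ^ k, k, by positivity, fun q => ?_⟩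
  have hsupp : tsupport (fun w => a (w, q)) ⊆ Metric.closedBall (c q) 2 := by
    refine closure_minimal (fun w hw => ?_) Metric.isClosed_closedBall
    rw [Metric.mem_closedBall, dist_eq_norm]
    exact hc w q hw
  refine ⟨ha.1.comp (contDiff_id.prodMk contDiff_const), fun w hw => hc w q hw, ?_⟩
  intro i hi w
  by_cases hw : w ∈ tsupport (fun w => a (w, q))
  · have hwq : 1 + ‖(w, q)‖ ≤ (3 + ‖c‖) * (1 + ‖q‖) := by
      have h1 : ‖w‖ ≤ ‖c‖ * ‖q‖ + 2 := by
        have h2 := hsupp hw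
        rw [Metric.mem_closedBall, dist_eq_norm] at h2
        have h3 := norm_le_norm_add_norm_sub' w (c q)
        have h4 := c.le_opNorm q
        linarith
      have h5 : ‖(w, q)‖ ≤ ‖c‖ * ‖q‖ + 2 + ‖q‖ :=
        max_le (h1.trans (by linarith [norm_nonneg q])) (by
          simp only
          nlinarith [norm_nonneg q, norm_nonneg c, mul_nonneg (norm_nonneg c) (norm_nonneg q)])
      nlinarith [norm_nonneg q, norm_nonneg c]
    have hL : ‖ContinuousLinearMap.inl ℝ (V × V) P‖ ≤ 1 := ContinuousLinearMap.norm_inl_le_one ..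
    have h6 := norm_iteratedFDeriv_comp_affine_le ha.1 _ hL (0, q) i w
    simp only [ContinuousLinearMap.inl_apply, Prod.mk_add_mk, add_zero, zero_add] at h6
    refine h6.trans ((h i hi (w, q)).trans ?_)
    rw [mul_assoc, ← mul_pow]
    gcongr
  · have h0 : iteratedFDeriv ℝ i (fun w => a (w, q)) w = 0 := by
      by_contra hne
      exact hw (support_iteratedFDeriv_subset i hne)
    rw [h0, norm_zero]
    positivity

theorem Function.HasTemperateGrowth.fst {D E F : Type*} [NormedAddCommGroup D]
    [NormedSpace ℝ D] [NormedAddCommGroup E] [NormedSpace ℝ E] [NormedAddCommGroup F]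
    [NormedSpace ℝ F] {f : D → E × F} (hf : f.HasTemperateGrowth) :
    (fun x => (f x).1).HasTemperateGrowth :=
  (ContinuousLinearMap.fst ℝ E F).hasTemperateGrowth.comp hf

theorem Function.HasTemperateGrowth.snd {D E F : Type*} [NormedAddCommGroup D]
    [NormedSpace ℝ D] [NormedAddCommGroup E] [NormedSpace ℝ E] [NormedAddCommGroup F]
    [NormedSpace ℝ F] {f : D → E × F} (hf : f.HasTemperateGrowth) :
    (fun x => (f x).2).HasTemperateGrowth :=
  (ContinuousLinearMap.snd ℝ E F).hasTemperateGrowth.comp hf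

section MatrixElement

variable {d : ℕ}

/-- The Euclidean dot product as a continuous bilinear form. -/
def dotForm (d : ℕ) : E1 d →L[ℝ] E1 d →L[ℝ] ℝ :=
  ∑ i, (ContinuousLinearMap.mul ℝ ℝ).bilinearComp
    (ContinuousLinearMap.proj (R := ℝ) (φ := fun _ : Fin d => ℝ) i)
    (ContinuousLinearMap.proj (R := ℝ) (φ := fun _ : Fin d => ℝ) i)

theorem dotForm_apply (x y : E1 d) : dotForm d x y = ∑ i, x i * y i := by
  simp [dotForm]

theorem exists_dotForm_eq_norm (x : E1 d) : ∃ u, ‖u‖ ≤ 1 ∧ dotForm d x u = ‖x‖ := by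
  rcases eq_or_ne x 0 with rfl | hx
  · exact ⟨0, by simp, by simp⟩
  have hle : ‖x‖ ≤ ∑ i, |x i| := by
    refine (pi_norm_le_iff_of_nonneg (by positivity)).2 fun i => ?_
    exact Finset.single_le_sum (f := fun i => |x i|) (fun i _ => abs_nonneg _) (Finset.mem_univ i)
  have hpos : 0 < ∑ i, |x i| := (norm_pos_iff.2 hx).trans_le hle
  refine ⟨fun i => ‖x‖ / (∑ i, |x i|) * SignType.sign (x i), ?_, ?_⟩
  · refine (pi_norm_le_iff_of_nonneg zero_le_one).2 fun i => ?_
    rw [norm_mul, Real.norm_eq_abs, abs_of_nonneg (by positivity)]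
    refine mul_le_one₀ ((div_le_one hpos).2 hle) (norm_nonneg _) ?_
    rcases lt_trichotomy (x i) 0 with h | h | h <;> simp [h]
  · rw [dotForm_apply]
    have : ∀ i, x i * (‖x‖ / (∑ i, |x i|) * SignType.sign (x i)) = ‖x‖ / (∑ i, |x i|) * |x i| := by
      intro i
      rw [← sign_mul_self (x i)]
      ring
    simp only [this]
    rw [← Finset.mul_sum, div_mul_cancel₀ _ hpos.ne']

/-- The bilinear form `(ξ, z) ↦ ξ_L·z_L − ξ_R·z_R`. -/
def splitForm (d : ℕ) : E2 d →L[ℝ] E2 d →L[ℝ] ℝ :=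
  (dotForm d).bilinearComp (ContinuousLinearMap.fst ℝ _ _) (ContinuousLinearMap.fst ℝ _ _)
    - (dotForm d).bilinearComp (ContinuousLinearMap.snd ℝ _ _) (ContinuousLinearMap.snd ℝ _ _)

theorem splitForm_apply (x y : E2 d) :
    splitForm d x y = (∑ i, x.1 i * y.1 i) - ∑ i, x.2 i * y.2 i := by
  rw [← dotForm_apply, ← dotForm_apply]
  rfl

theorem splitForm_comm (x y : E2 d) : splitForm d x y = splitForm d y x := by
  simp only [splitForm_apply, mul_comm]

theorem exists_splitForm_eq_norm (x : E2 d) : ∃ u, ‖u‖ ≤ 1 ∧ splitForm d x u = ‖x‖ := by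
  rcases le_total ‖x.2‖ ‖x.1‖ with h | h
  · obtain ⟨u, hu, hu'⟩ := exists_dotForm_eq_norm x.1
    refine ⟨(u, 0), by simpa [Prod.norm_def], ?_⟩
    rw [Prod.norm_def, max_eq_left h, ← hu']
    simp [splitForm]
  · obtain ⟨u, hu, hu'⟩ := exists_dotForm_eq_norm x.2
    refine ⟨(0, -u), by simpa [Prod.norm_def], ?_⟩
    rw [Prod.norm_def, max_eq_right h, ← hu']
    simp [splitForm]

/-- The amplitude of the kernel `gaborKernel4`, at `((v, z), (a, c))` where `a`, `c` are the
positions of the two frame indices. -/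
def gaborAmplitude (d : ℕ) (B : Fin d → Fin d → E1 d → ℝ) (g : E1 d → ℝ)
    (q : (E2 d × E2 d) × (E2 d × E2 d)) : ℂ :=
  Complex.exp (Complex.I *
    ((magPhi d B (q.1.1.1 + (2 : ℝ)⁻¹ • q.1.2.1) (q.1.1.1 - (2 : ℝ)⁻¹ • q.1.2.1)
    - magPhi d B (q.1.1.2 + (2 : ℝ)⁻¹ • q.1.2.2) (q.1.1.2 - (2 : ℝ)⁻¹ • q.1.2.2)
    + magPhi d B (q.1.1.1 + (2 : ℝ)⁻¹ • q.1.2.1) q.2.2.1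
    - magPhi d B (q.1.1.2 + (2 : ℝ)⁻¹ • q.1.2.2) q.2.2.2
    - magPhi d B (q.1.1.1 - (2 : ℝ)⁻¹ • q.1.2.1) q.2.1.1
    + magPhi d B (q.1.1.2 - (2 : ℝ)⁻¹ • q.1.2.2) q.2.1.2 : ℝ) : ℂ)) *
  ((g (q.1.1.1 + (2 : ℝ)⁻¹ • q.1.2.1 - q.2.2.1) * g (q.1.1.2 + (2 : ℝ)⁻¹ • q.1.2.2 - q.2.2.2) *
    (g (q.1.1.1 - (2 : ℝ)⁻¹ • q.1.2.1 - q.2.1.1) * g (q.1.1.2 - (2 : ℝ)⁻¹ • q.1.2.2 - q.2.1.2)) :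
      ℝ) : ℂ)

theorem IsRegularMagneticField.hasTemperateGrowth_magPhi_comp {D : Type*} [NormedAddCommGroup D]
    [NormedSpace ℝ D] {B : Fin d → Fin d → E1 d → ℝ} (hB : IsRegularMagneticField d B)
    {f₁ f₂ : D → E1 d} (h₁ : f₁.HasTemperateGrowth) (h₂ : f₂.HasTemperateGrowth) :
    (fun x => magPhi d B (f₁ x) (f₂ x)).HasTemperateGrowth := by
  have h := hB.hasTemperateGrowth_magPhi.comp (h₁.prodMk h₂)
  exact h

theorem hasTemperateGrowth_gaborAmplitude {B : Fin d → Fin d → E1 d → ℝ} {g : E1 d → ℝ}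
    (hB : IsRegularMagneticField d B) (hg : IsWindow d g) :
    (gaborAmplitude d B g).HasTemperateGrowth := by
  have hid : (fun q : (E2 d × E2 d) × (E2 d × E2 d) => q).HasTemperateGrowth :=
    Function.HasTemperateGrowth.id'
  have hhalf : ∀ {f : (E2 d × E2 d) × (E2 d × E2 d) → E1 d}, f.HasTemperateGrowth →
      (fun q => (2 : ℝ)⁻¹ • f q).HasTemperateGrowth :=
    fun hf => ((2 : ℝ)⁻¹ • ContinuousLinearMap.id ℝ (E1 d)).hasTemperateGrowth.comp hf
  have hgc : ∀ {f : (E2 d × E2 d) × (E2 d × E2 d) → E1 d}, f.HasTemperateGrowth →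
      (fun q => g (f q)).HasTemperateGrowth := fun hf => hg.hasTemperateGrowth.comp hf
  have hvL : (fun q : (E2 d × E2 d) × (E2 d × E2 d) => q.1.1.1).HasTemperateGrowth :=
    hid.fst.fst.fst
  have hvR : (fun q : (E2 d × E2 d) × (E2 d × E2 d) => q.1.1.2).HasTemperateGrowth :=
    hid.fst.fst.snd
  have hzL : (fun q : (E2 d × E2 d) × (E2 d × E2 d) => (2 : ℝ)⁻¹ • q.1.2.1).HasTemperateGrowth :=
    hhalf hid.fst.snd.fst
  have hzR : (fun q : (E2 d × E2 d) × (E2 d × E2 d) => (2 : ℝ)⁻¹ • q.1.2.2).HasTemperateGrowth :=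
    hhalf hid.fst.snd.snd
  have haL : (fun q : (E2 d × E2 d) × (E2 d × E2 d) => q.2.1.1).HasTemperateGrowth :=
    hid.snd.fst.fst
  have haR : (fun q : (E2 d × E2 d) × (E2 d × E2 d) => q.2.1.2).HasTemperateGrowth :=
    hid.snd.fst.snd
  have hcL : (fun q : (E2 d × E2 d) × (E2 d × E2 d) => q.2.2.1).HasTemperateGrowth :=
    hid.snd.snd.fst
  have hcR : (fun q : (E2 d × E2 d) × (E2 d × E2 d) => q.2.2.2).HasTemperateGrowth :=
    hid.snd.snd.snd
  have hxL : (fun q : (E2 d × E2 d) × (E2 d × E2 d) => q.1.1.1 + (2 : ℝ)⁻¹ • q.1.2.1).HasTemperateGrowth :=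
    hvL.fun_add hzL
  have hyL : (fun q : (E2 d × E2 d) × (E2 d × E2 d) => q.1.1.1 - (2 : ℝ)⁻¹ • q.1.2.1).HasTemperateGrowth :=
    hvL.fun_sub hzL
  have hxR : (fun q : (E2 d × E2 d) × (E2 d × E2 d) => q.1.1.2 + (2 : ℝ)⁻¹ • q.1.2.2).HasTemperateGrowth :=
    hvR.fun_add hzR
  have hyR : (fun q : (E2 d × E2 d) × (E2 d × E2 d) => q.1.1.2 - (2 : ℝ)⁻¹ • q.1.2.2).HasTemperateGrowth :=
    hvR.fun_sub hzR
  have hphase := (((((hB.hasTemperateGrowth_magPhi_comp hxL hyL).fun_sub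
    (hB.hasTemperateGrowth_magPhi_comp hxR hyR)).fun_add
    (hB.hasTemperateGrowth_magPhi_comp hxL hcL)).fun_sub
    (hB.hasTemperateGrowth_magPhi_comp hxR hcR)).fun_sub
    (hB.hasTemperateGrowth_magPhi_comp hyL haL)).fun_add
    (hB.hasTemperateGrowth_magPhi_comp hyR haR)
  have hcut := ((hgc (hxL.fun_sub hcL)).fun_mul (hgc (hxR.fun_sub hcR))).fun_mul
    ((hgc (hyL.fun_sub haL)).fun_mul (hgc (hyR.fun_sub haR)))
  exact (hasTemperateGrowth_cexp_I_mul.comp hphase).fun_mul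
    (Complex.ofRealCLM.hasTemperateGrowth.comp hcut)

/-- The centre of the support of `gaborAmplitude`. -/
def gaborCentre (d : ℕ) : E2 d × E2 d →L[ℝ] E2 d × E2 d :=
  ((2 : ℝ)⁻¹ • (ContinuousLinearMap.fst ℝ (E2 d) (E2 d) + ContinuousLinearMap.snd ℝ (E2 d) (E2 d))).prod
    (ContinuousLinearMap.snd ℝ (E2 d) (E2 d) - ContinuousLinearMap.fst ℝ (E2 d) (E2 d))

theorem IsWindow.norm_le_one {g : E1 d → ℝ} (hg : IsWindow d g) {x : E1 d} (hx : g x ≠ 0) :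
    ‖x‖ ≤ 1 :=
  (pi_norm_le_iff_of_nonneg zero_le_one).2 fun i => (hg.support_subset x hx i).le

theorem gaborAmplitude_support {B : Fin d → Fin d → E1 d → ℝ} {g : E1 d → ℝ}
    (hg : IsWindow d g) (w q : E2 d × E2 d) (h : gaborAmplitude d B g (w, q) ≠ 0) :
    ‖w - gaborCentre d q‖ ≤ 2 := by
  have h1 := right_ne_zero_of_mul h
  rw [Complex.ofReal_ne_zero] at h1
  have hxL := hg.norm_le_one (left_ne_zero_of_mul (left_ne_zero_of_mul h1))
  have hxR := hg.norm_le_one (right_ne_zero_of_mul (left_ne_zero_of_mul h1))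
  have hyL := hg.norm_le_one (left_ne_zero_of_mul (right_ne_zero_of_mul h1))
  have hyR := hg.norm_le_one (right_ne_zero_of_mul (right_ne_zero_of_mul h1))
  have key : ∀ v z a c : E1 d, ‖v + (2 : ℝ)⁻¹ • z - c‖ ≤ 1 → ‖v - (2 : ℝ)⁻¹ • z - a‖ ≤ 1 →
      ‖v - (2 : ℝ)⁻¹ • (a + c)‖ ≤ 2 ∧ ‖z - (c - a)‖ ≤ 2 := by
    intro v z a c hx hy
    have e1 : v - (2 : ℝ)⁻¹ • (a + c) = (2 : ℝ)⁻¹ • ((v + (2 : ℝ)⁻¹ • z - c)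
        + (v - (2 : ℝ)⁻¹ • z - a)) := by module
    have e2 : z - (c - a) = (v + (2 : ℝ)⁻¹ • z - c) - (v - (2 : ℝ)⁻¹ • z - a) := by module
    rw [e1, e2, norm_smul, Real.norm_of_nonneg (by norm_num)]
    have h2 := norm_add_le (v + (2 : ℝ)⁻¹ • z - c) (v - (2 : ℝ)⁻¹ • z - a)
    have h3 := norm_sub_le (v + (2 : ℝ)⁻¹ • z - c) (v - (2 : ℝ)⁻¹ • z - a)
    constructor <;> linarith
  obtain ⟨k1, k2⟩ := key w.1.1 w.2.1 q.1.1 q.2.1 hxL hyL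
  obtain ⟨k3, k4⟩ := key w.1.2 w.2.2 q.1.2 q.2.2 hxR hyR
  exact max_le (max_le k1 k3) (max_le k2 k4)

/-- Positions of a pair of frame indices. -/
def Idx2.pos (a : Idx2 d) : E2 d := (fun i => (a.1.1 i : ℝ), fun i => (a.2.1 i : ℝ))

/-- Frequencies of a pair of frame indices. -/
def Idx2.freq (a : Idx2 d) : E2 d := (fun i => (a.1.2 i : ℝ), fun i => (a.2.2 i : ℝ))

end MatrixElement

section MatrixElement

variable {d : ℕ}

theorem cexp_I_mul_mul_cexp_I_mul (a b : ℝ) :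
    Complex.exp (Complex.I * (a : ℂ)) * Complex.exp (Complex.I * (b : ℂ))
      = Complex.exp (Complex.I * ((a + b : ℝ) : ℂ)) := by
  rw [← Complex.exp_add, Complex.ofReal_add, mul_add]

theorem gabor_eq (B : Fin d → Fin d → E1 d → ℝ) (g : E1 d → ℝ) (a : Idx d) (x : E1 d) :
    gabor d B g a x = (((2 * Real.pi) ^ (-(d : ℝ) / 2) : ℝ) : ℂ) *
      Complex.exp (Complex.I * ((magPhi d B x (fun i => (a.1 i : ℝ))
        + dotForm d (fun i => (a.2 i : ℝ)) (x - fun i => (a.1 i : ℝ)) : ℝ) : ℂ)) *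
      (g (x - fun i => (a.1 i : ℝ)) : ℂ) := by
  rw [gabor, ← cexp_I_mul_mul_cexp_I_mul, dotForm_apply]
  simp only [Pi.sub_apply]
  ring

theorem conj_gabor_eq (B : Fin d → Fin d → E1 d → ℝ) (g : E1 d → ℝ) (a : Idx d) (x : E1 d) :
    (starRingEnd ℂ) (gabor d B g a x) = (((2 * Real.pi) ^ (-(d : ℝ) / 2) : ℝ) : ℂ) *
      Complex.exp (Complex.I * ((-(magPhi d B x (fun i => (a.1 i : ℝ))
        + dotForm d (fun i => (a.2 i : ℝ)) (x - fun i => (a.1 i : ℝ))) : ℝ) : ℂ)) *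
      (g (x - fun i => (a.1 i : ℝ)) : ℂ) := by
  rw [gabor_eq, map_mul, map_mul, ← Complex.exp_conj, map_mul, Complex.conj_I]
  simp only [Complex.conj_ofReal, Complex.ofReal_neg, mul_neg, neg_mul]

/-- The constant phase of `gaborKernel4`. -/
def gaborConstPhase (ab gd : Idx2 d) : ℝ :=
  splitForm d ab.freq ab.pos - splitForm d gd.freq gd.pos

theorem gaborKernel4_eq (B : Fin d → Fin d → E1 d → ℝ) (g : E1 d → ℝ) (ab gd : Idx2 d)
    (X : E4 d) (z : E2 d) :
    gaborKernel4 d B g ab gd X z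
      = ((((2 * Real.pi) ^ (-(d : ℝ) / 2) : ℝ) : ℂ) ^ 4 *
          Complex.exp (Complex.I * (gaborConstPhase ab gd : ℂ))) *
        (Complex.exp (Complex.I * ((splitForm d (gd.freq - ab.freq) (X.1.1, X.2.1)
          + splitForm d ((X.1.2, X.2.2) + (2 : ℝ)⁻¹ • (gd.freq + ab.freq)) z : ℝ) : ℂ)) *
        gaborAmplitude d B g (((X.1.1, X.2.1), z), (ab.pos, gd.pos))) := by
  rw [gaborKernel4, conj_gabor_eq, conj_gabor_eq, gabor_eq, gabor_eq, gaborAmplitude]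
  have key : ∀ (c : ℂ) (g₁ g₂ g₃ g₄ t₁ t₂ t₃ t₄ t₅ t₆ s₁ s₂ s₃ : ℝ),
      t₁ + t₂ + t₃ + t₄ + t₅ + t₆ = s₁ + s₂ + s₃ →
      Complex.exp (Complex.I * (t₁ : ℂ)) * Complex.exp (Complex.I * (t₂ : ℂ)) *
        (c * Complex.exp (Complex.I * (t₃ : ℂ)) * (g₁ : ℂ)) *
        (c * Complex.exp (Complex.I * (t₄ : ℂ)) * (g₂ : ℂ)) *
        (c * Complex.exp (Complex.I * (t₅ : ℂ)) * (g₃ : ℂ)) *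
        (c * Complex.exp (Complex.I * (t₆ : ℂ)) * (g₄ : ℂ))
        = (c ^ 4 * Complex.exp (Complex.I * (s₁ : ℂ))) * (Complex.exp (Complex.I * (s₂ : ℂ)) *
          (Complex.exp (Complex.I * (s₃ : ℂ)) * ((g₁ * g₂ * (g₃ * g₄) : ℝ) : ℂ))) := by
    intro c g₁ g₂ g₃ g₄ t₁ t₂ t₃ t₄ t₅ t₆ s₁ s₂ s₃ h
    have h1 : Complex.exp (Complex.I * ((t₁ + t₂ + t₃ + t₄ + t₅ + t₆ : ℝ) : ℂ))
        = Complex.exp (Complex.I * ((s₁ + s₂ + s₃ : ℝ) : ℂ)) := by rw [h]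
    simp only [← cexp_I_mul_mul_cexp_I_mul] at h1
    push_cast
    linear_combination (c ^ 4 * (g₁ * g₂ * (g₃ * g₄))) * h1
  dsimp only [Idx2.pos]
  generalize magPhi d B (X.1.1 + (2 : ℝ)⁻¹ • z.1) (X.1.1 - (2 : ℝ)⁻¹ • z.1) = m₁
  generalize magPhi d B (X.2.1 + (2 : ℝ)⁻¹ • z.2) (X.2.1 - (2 : ℝ)⁻¹ • z.2) = m₂
  generalize magPhi d B (X.1.1 + (2 : ℝ)⁻¹ • z.1) _ = m₃
  generalize magPhi d B (X.2.1 + (2 : ℝ)⁻¹ • z.2) _ = m₄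
  generalize magPhi d B (X.1.1 - (2 : ℝ)⁻¹ • z.1) _ = m₅
  generalize magPhi d B (X.2.1 - (2 : ℝ)⁻¹ • z.2) _ = m₆
  generalize g (X.1.1 + (2 : ℝ)⁻¹ • z.1 - _) = g₁
  generalize g (X.2.1 + (2 : ℝ)⁻¹ • z.2 - _) = g₂
  generalize g (X.1.1 - (2 : ℝ)⁻¹ • z.1 - _) = g₃
  generalize g (X.2.1 - (2 : ℝ)⁻¹ • z.2 - _) = g₄
  refine key _ _ _ _ _ _ _ _ _ _ _ _ _ _ ?_
  simp only [gaborConstPhase, Idx2.freq, Idx2.pos, splitForm, sub_apply,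
    ContinuousLinearMap.bilinearComp_apply, ContinuousLinearMap.coe_fst',
    ContinuousLinearMap.coe_snd', map_add, map_sub, map_smul, add_apply, smul_apply, smul_eq_mul,
    ← dotForm_apply]
  ring

instance (d : ℕ) : (volume : Measure (E4 d)).IsAddHaarMeasure :=
  isAddHaarMeasure_volume_prod (E := E2 d) (F := E2 d)

instance (d : ℕ) : (volume : Measure (E4 d × E2 d)).IsAddHaarMeasure :=
  isAddHaarMeasure_volume_prod (E := E4 d) (F := E2 d)

instance (d : ℕ) : (volume : Measure (E2 d × E4 d)).IsAddHaarMeasure :=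
  isAddHaarMeasure_volume_prod (E := E2 d) (F := E4 d)

/-- Regrouping of phase-space variables into positions and frequencies. -/
def phaseRegroup (d : ℕ) : E4 d ≃L[ℝ] E2 d × E2 d :=
  LinearEquiv.toContinuousLinearEquiv
    { toFun := fun X => ((X.1.1, X.2.1), (X.1.2, X.2.2))
      invFun := fun Y => ((Y.1.1, Y.2.1), (Y.1.2, Y.2.2))
      left_inv := fun _ => rfl
      right_inv := fun _ => rfl
      map_add' := fun _ _ => rfl
      map_smul' := fun _ _ => rfl }

theorem phaseRegroup_symm_apply (Y : E2 d × E2 d) :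
    (phaseRegroup d).symm Y = ((Y.1.1, Y.2.1), (Y.1.2, Y.2.2)) := rfl

theorem norm_phaseRegroup_symm_apply (Y : E2 d × E2 d) : ‖(phaseRegroup d).symm Y‖ = ‖Y‖ := by
  rw [phaseRegroup_symm_apply]
  simp only [Prod.norm_def]
  exact max_max_max_comm _ _ _ _

/-- Regrouping `((v, ξ), z)` as `(ξ, (v, z))`. -/
def oscRegroup (d : ℕ) : (E4 d × E2 d) ≃L[ℝ] E2 d × (E2 d × E2 d) :=
  LinearEquiv.toContinuousLinearEquiv
    { toFun := fun p => ((p.1.1.2, p.1.2.2), ((p.1.1.1, p.1.2.1), p.2))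
      invFun := fun q => (((q.2.1.1, q.1.1), (q.2.1.2, q.1.2)), q.2.2)
      left_inv := fun _ => rfl
      right_inv := fun _ => rfl
      map_add' := fun _ _ => rfl
      map_smul' := fun _ _ => rfl }

theorem oscRegroup_apply (p : E4 d × E2 d) :
    oscRegroup d p = ((p.1.1.2, p.1.2.2), ((p.1.1.1, p.1.2.1), p.2)) := rfl

/-- Up to a bounded factor, matrix elements of compactly supported symbols are oscillatory
integrals. -/
theorem exists_norm_integral_matH_eq {B : Fin d → Fin d → E1 d → ℝ} {g : E1 d → ℝ}
    (hB : IsRegularMagneticField d B) (hg : IsWindow d g) :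
    ∃ K : ℝ, 0 ≤ K ∧ ∀ (ab gd : Idx2 d) (Ψ : E4 d → ℂ), ContDiff ℝ ∞ Ψ → HasCompactSupport Ψ →
      ‖∫ X, Ψ X * matH d B g ab gd X‖
        = K * ‖oscIntegral (splitForm d) (Ψ ∘ (phaseRegroup d).symm)
          (fun w => gaborAmplitude d B g (w, (ab.pos, gd.pos))) (gd.freq - ab.freq)
          ((2 : ℝ)⁻¹ • (gd.freq + ab.freq))‖ := by
  obtain ⟨κ, hκ, hκ'⟩ := exists_integral_comp_continuousLinearEquiv (oscRegroup d)
  refine ⟨(2 * Real.pi) ^ (-(2 * (d : ℝ))) * ((2 * Real.pi) ^ (-(d : ℝ) / 2)) ^ 4 * κ,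
    by positivity, fun ab gd Ψ hΨ hΨc => ?_⟩
  obtain ⟨C, k, -, hr⟩ := (hasTemperateGrowth_gaborAmplitude hB hg).exists_isLocalAmplitude
    (gaborCentre d) (gaborAmplitude_support hg) 0
  have hr := hr (ab.pos, gd.pos)
  set r : E2 d × E2 d → ℂ := fun w => gaborAmplitude d B g (w, (ab.pos, gd.pos))
  set η := gd.freq - ab.freq with hη
  set σ := (2 : ℝ)⁻¹ • (gd.freq + ab.freq) with hσ
  have hΨ' : ContDiff ℝ ∞ (Ψ ∘ (phaseRegroup d).symm) :=
    hΨ.comp (phaseRegroup d).symm.contDiff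
  have hΨc' : HasCompactSupport (Ψ ∘ (phaseRegroup d).symm) :=
    hΨc.comp_homeomorph (phaseRegroup d).symm.toHomeomorph
  set f : E2 d × (E2 d × E2 d) → ℂ := fun p =>
    Complex.exp (Complex.I * ((splitForm d η p.2.1 + splitForm d (p.1 + σ) p.2.2 : ℝ) : ℂ)) *
      ((Ψ ∘ (phaseRegroup d).symm) (p.2.1, p.1) * r p.2) with hf
  have hfc : Continuous f :=
    (contDiff_cexp_I_mul (contDiff_oscPhase (splitForm d) η σ)).continuous.mul
      (contDiff_symbol_mul hΨ' hr.smooth).continuous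
  have hfs : HasCompactSupport f :=
    (hasCompactSupport_symbol_mul hΨc' hr.hasCompactSupport).mul_left
  have hint : Integrable fun p => f (oscRegroup d p) :=
    (hfc.comp (oscRegroup d).continuous).integrable_of_hasCompactSupport
      (hfs.comp_homeomorph (oscRegroup d).toHomeomorph)
  set A : ℂ := (((2 * Real.pi) ^ (-(2 * (d : ℝ))) : ℝ) : ℂ) *
    ((((2 * Real.pi) ^ (-(d : ℝ) / 2) : ℝ) : ℂ) ^ 4 *
          Complex.exp (Complex.I * (gaborConstPhase ab gd : ℂ))) with hA
  have h1 : ∀ X, Ψ X * matH d B g ab gd X = A * ∫ z, f (oscRegroup d (X, z)) := by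
    intro X
    rw [matH, hA, mul_assoc _ _ (∫ z, f (oscRegroup d (X, z))), mul_left_comm]
    congr 1
    rw [← integral_const_mul, ← integral_const_mul]
    congr 1
    funext z
    rw [gaborKernel4_eq, hf]
    simp only [oscRegroup_apply, Function.comp_apply, phaseRegroup_symm_apply]
    ring
  simp only [h1]
  rw [integral_const_mul, ← integral_prod (fun p : E4 d × E2 d => f (oscRegroup d p)) hint]
  have h2 := hκ' f
  rw [Measure.volume_eq_prod] at h2
  have hAn : ‖A‖ = (2 * Real.pi) ^ (-(2 * (d : ℝ))) * ((2 * Real.pi) ^ (-(d : ℝ) / 2)) ^ 4 := by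
    rw [hA, norm_mul, norm_mul, norm_cexp_I_mul, norm_pow, Complex.norm_real, Complex.norm_real,
      Real.norm_of_nonneg (by positivity), Real.norm_of_nonneg (by positivity), mul_one]
  rw [h2, norm_mul A, hAn, norm_mul, Complex.norm_real, Real.norm_of_nonneg hκ]
  have h3 : ∫ y, f y = oscIntegral (splitForm d) (Ψ ∘ (phaseRegroup d).symm) r η σ := rfl
  rw [h3]
  ring

end MatrixElement

section Symbol

theorem jbE4_le {d : ℕ} (u : E4 d) : jbE4 d u ≤ (1 + 4 * d) * (1 + ‖u‖) := by
  have hsum : ∀ x : E1 d, ‖x‖ ≤ ‖u‖ → ∑ i, x i ^ 2 ≤ d * ‖u‖ ^ 2 := by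
    intro x hx
    calc ∑ i, x i ^ 2 ≤ ∑ _i : Fin d, ‖u‖ ^ 2 := by
          refine Finset.sum_le_sum fun i _ => ?_
          rw [← sq_abs]
          exact pow_le_pow_left₀ (abs_nonneg _) ((norm_le_pi_norm x i).trans hx) 2
      _ = d * ‖u‖ ^ 2 := by simp
  have h1 := hsum u.1.1 ((norm_fst_le u.1).trans (norm_fst_le u))
  have h2 := hsum u.1.2 ((norm_snd_le u.1).trans (norm_fst_le u))
  have h3 := hsum u.2.1 ((norm_fst_le u.2).trans (norm_snd_le u))
  have h4 := hsum u.2.2 ((norm_snd_le u.2).trans (norm_snd_le u))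
  refine Real.sqrt_le_iff.2 ⟨by positivity, ?_⟩
  have hd : (0 : ℝ) ≤ d := Nat.cast_nonneg d
  have hu := norm_nonneg u
  have h5 : 1 + 4 * d * ‖u‖ ^ 2 ≤ ((1 + 4 * d) * (1 + ‖u‖)) ^ 2 := by
    have : 0 ≤ (d : ℝ) * ‖u‖ := by positivity
    nlinarith [mul_nonneg hd hd, mul_nonneg hd (sq_nonneg ‖u‖), mul_nonneg this this,
      mul_nonneg hd this, sq_nonneg ‖u‖]
  linarith

theorem one_le_jbE4 {d : ℕ} (u : E4 d) : 1 ≤ jbE4 d u := by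
  refine Real.one_le_sqrt.2 ?_
  have h : ∀ x : E1 d, 0 ≤ ∑ i, x i ^ 2 := fun x => Finset.sum_nonneg fun i _ => sq_nonneg _
  linarith [h u.1.1, h u.1.2, h u.2.1, h u.2.2]

/-- Symbols dominated by a tempered weight have polynomial growth. -/
theorem InS0.exists_isSymbol {d : ℕ} {M : E4 d → ℝ} {Φ : E4 d → ℂ} (hΦ : InS0 d M Φ)
    (hM : IsTemperedWeightE4 d M) : ∃ p D, IsSymbol p D Φ := by
  obtain ⟨hpos, C, hC, a, -, hMb⟩ := hM
  choose c hc using hΦ.2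
  refine ⟨⌈a⌉₊, fun k => |c k| * (C * M 0 * (1 + 4 * d) ^ ⌈a⌉₊), hΦ.1, fun k X => ?_⟩
  have hM0 := hpos 0
  have hjb : jbE4 d X ^ a ≤ ((1 + 4 * d) * (1 + ‖X‖)) ^ ⌈a⌉₊ := by
    refine (Real.rpow_le_rpow_of_exponent_le (one_le_jbE4 X) (Nat.le_ceil a)).trans ?_
    rw [Real.rpow_natCast]
    exact pow_le_pow_left₀ (zero_le_one.trans (one_le_jbE4 X)) (jbE4_le X) _
  have hMX : M X ≤ C * M 0 * ((1 + 4 * d) * (1 + ‖X‖)) ^ ⌈a⌉₊ := by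
    have := hMb 0 X
    rw [zero_add] at this
    exact this.trans (by gcongr)
  calc ‖iteratedFDeriv ℝ k Φ X‖ ≤ c k * M X := hc k X
    _ ≤ |c k| * (C * M 0 * ((1 + 4 * d) * (1 + ‖X‖)) ^ ⌈a⌉₊) :=
        mul_le_mul (le_abs_self _) hMX (hpos X).le (abs_nonneg _)
    _ = _ := by rw [mul_pow]; ring

variable {E : Type*} [NormedAddCommGroup E] [NormedSpace ℝ E]

theorem IsSymbol.mul_of_bounded {p : ℕ} {D A : ℕ → ℝ} {Φ χ : E → ℂ} (hΦ : IsSymbol p D Φ)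
    (hχ : ContDiff ℝ ∞ χ) (hA : ∀ k X, ‖iteratedFDeriv ℝ k χ X‖ ≤ A k) :
    IsSymbol p (fun k => 2 ^ k * (∑ i ∈ Finset.range (k + 1), A i) *
      ∑ i ∈ Finset.range (k + 1), D i) (fun X => χ X * Φ X) where
  smooth := hχ.mul hΦ.smooth
  bound k X := by
    have hA0 : ∀ i, 0 ≤ A i := fun i => (norm_nonneg _).trans (hA i 0)
    have hD0 : ∀ i, 0 ≤ D i := fun i => by simpa using (norm_nonneg _).trans (hΦ.bound i 0)
    have hle : ∀ {a : ℕ → ℝ}, (∀ i, 0 ≤ a i) → ∀ i ≤ k, a i ≤ ∑ i ∈ Finset.range (k + 1), a i :=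
      fun ha i hi => Finset.single_le_sum (fun j _ => ha j) (Finset.mem_range.2 (by omega))
    rw [mul_assoc (_ * _)]
    refine norm_iteratedFDeriv_mul_le_of_bounds hχ hΦ.smooth
      (fun i hi => (hA i X).trans (hle hA0 i hi)) (fun i hi => (hΦ.bound i X).trans ?_) le_rfl
    gcongr
    exact hle hD0 i hi

theorem IsSymbol.comp_isometry {F : Type*} [NormedAddCommGroup F] [NormedSpace ℝ F] {p : ℕ}
    {D : ℕ → ℝ} {Φ : F → ℂ} (hΦ : IsSymbol p D Φ) (L : E →L[ℝ] F) (hL : ∀ x, ‖L x‖ = ‖x‖) :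
    IsSymbol p D (Φ ∘ L) where
  smooth := hΦ.smooth.comp L.contDiff
  bound k X := by
    have h := norm_iteratedFDeriv_comp_affine_le hΦ.smooth L
      (L.opNorm_le_bound zero_le_one fun x => by rw [hL, one_mul]) 0 k X
    simp only [add_zero] at h
    have h' := h.trans (hΦ.bound k (L X))
    rwa [hL] at h'

variable (E) in
/-- Compactly supported approximations of the constant function `1`. -/
theorem exists_cutoff [FiniteDimensional ℝ E] :
    ∃ (χ : ℕ → E → ℂ) (A : ℕ → ℝ), (∀ n, ContDiff ℝ ∞ (χ n)) ∧ (∀ n, HasCompactSupport (χ n)) ∧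
      (∀ n k x, ‖iteratedFDeriv ℝ k (χ n) x‖ ≤ A k) ∧ ∀ x, ∀ᶠ n in atTop, χ n x = 1 := by
  let b : ContDiffBump (0 : E) := ⟨1, 2, one_pos, one_lt_two⟩
  let χ₀ : E → ℂ := fun x => (b x : ℂ)
  have hs : ContDiff ℝ ∞ χ₀ := Complex.ofRealCLM.contDiff.comp b.contDiff
  have hc : HasCompactSupport χ₀ := b.hasCompactSupport.comp_left Complex.ofReal_zero
  have hbd : ∀ k, ∃ A, ∀ x, ‖iteratedFDeriv ℝ k χ₀ x‖ ≤ A := fun k =>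
    (hc.iteratedFDeriv k).exists_bound_of_continuous (hs.continuous_iteratedFDeriv (mod_cast le_top))
  choose A hA using hbd
  let L : ℕ → E →L[ℝ] E := fun n => ((n : ℝ) + 1)⁻¹ • ContinuousLinearMap.id ℝ E
  have hL : ∀ n, ‖L n‖ ≤ 1 := fun n => by
    refine ContinuousLinearMap.opNorm_le_bound _ zero_le_one fun x => ?_
    rw [smul_apply, ContinuousLinearMap.id_apply, norm_smul, norm_inv,
      Real.norm_of_nonneg (by positivity)]
    gcongr
    exact inv_le_one_of_one_le₀ (by simp)
  refine ⟨fun n x => χ₀ (L n x), A, fun n => hs.comp (L n).contDiff, fun n => ?_,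
    fun n k x => ?_, fun x => ?_⟩
  · have h := hc.comp_homeomorph (Homeomorph.smulOfNeZero ((n : ℝ) + 1)⁻¹ (by positivity))
    exact h
  · have h := norm_iteratedFDeriv_comp_affine_le hs (L n) (hL n) 0 k x
    simp only [add_zero] at h
    exact h.trans (hA k _)
  · filter_upwards [eventually_ge_atTop ⌈‖x‖⌉₊] with n hn
    have hx : ‖L n x‖ ≤ 1 := by
      rw [smul_apply, ContinuousLinearMap.id_apply, norm_smul, norm_inv,
        Real.norm_of_nonneg (by positivity), inv_mul_le_one₀ (by positivity)]
      exact (Nat.ceil_le.1 hn).trans (by linarith)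
    have : b (L n x) = 1 := b.one_of_mem_closedBall (by simpa using hx)
    simp [χ₀, this]

end Symbol

section MatrixElement

variable {d : ℕ}

theorem exists_matElem_bound {B : Fin d → Fin d → E1 d → ℝ} {g : E1 d → ℝ}
    (hB : IsRegularMagneticField d B) (hg : IsWindow d g) {p N : ℕ} {D : ℕ → ℝ} {Φ : E4 d → ℂ}
    (hΦ : IsSymbol p D Φ) (hN : p + Module.finrank ℝ (E2 d) < N) :
    ∃ k : ℕ, ∀ m : ℕ, ∃ C : ℝ, 0 ≤ C ∧ ∀ ab gd : Idx2 d,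
      (1 + ‖gd.pos - ab.pos‖) ^ m * (1 + ‖gd.freq - ab.freq‖) ^ N * ‖matElem d B g Φ ab gd‖
        ≤ C * (1 + ‖(ab.pos, gd.pos)‖) ^ k * (1 + ‖gaborCentre d (ab.pos, gd.pos)‖) ^ p *
          (1 + ‖(2 : ℝ)⁻¹ • (gd.freq + ab.freq)‖) ^ p := by
  obtain ⟨C₀, k, hC₀, hr⟩ := (hasTemperateGrowth_gaborAmplitude hB hg).exists_isLocalAmplitude
    (gaborCentre d) (gaborAmplitude_support hg) (2 * N)
  obtain ⟨χ, A, hχ, hχc, hA, hχ1⟩ := exists_cutoff (E4 d)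
  obtain ⟨K, hK, hKeq⟩ := exists_norm_integral_matH_eq hB hg
  refine ⟨k, fun m => ?_⟩
  obtain ⟨C, hC, hosc⟩ := exists_oscIntegral_decay (exists_splitForm_eq_norm (d := d))
    (fun x => by simpa only [splitForm_comm] using exists_splitForm_eq_norm x) hN m
    (fun k => 2 ^ k * (∑ i ∈ Finset.range (k + 1), A i) * ∑ i ∈ Finset.range (k + 1), D i)
  refine ⟨K * (C * C₀), by positivity, fun ab gd => ?_⟩
  by_cases hint : Integrable fun X => Φ X * matH d B g ab gd X
  swap
  · rw [matElem, integral_undef hint, norm_zero, mul_zero]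
    positivity
  have hlim : Tendsto (fun n => ∫ X, χ n X * Φ X * matH d B g ab gd X) atTop
      (nhds (matElem d B g Φ ab gd)) := by
    refine tendsto_integral_of_dominated_convergence
      (fun X => A 0 * ‖Φ X * matH d B g ab gd X‖) (fun n => ?_) (hint.norm.const_mul _)
      (fun n => ae_of_all _ fun X => ?_) (ae_of_all _ fun X => ?_)
    · simp only [mul_assoc]
      exact (hχ n).continuous.aestronglyMeasurable.mul hint.aestronglyMeasurable
    · rw [mul_assoc, norm_mul]
      gcongr
      simpa using hA n 0 X
    · refine tendsto_const_nhds.congr' ?_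
      filter_upwards [hχ1 X] with n hn
      rw [hn, one_mul]
  refine le_of_tendsto (hlim.norm.const_mul _) (Eventually.of_forall fun n => ?_)
  have hsym := hΦ.mul_of_bounded (hχ n) (hA n)
  have hsupp : HasCompactSupport fun X => χ n X * Φ X := (hχc n).mul_right
  have h := hosc _ _ (gd.freq - ab.freq) ((2 : ℝ)⁻¹ • (gd.freq + ab.freq)) _ _
    (hsym.comp_isometry ((phaseRegroup d).symm : E2 d × E2 d →L[ℝ] E4 d)
      norm_phaseRegroup_symm_apply)
    (hsupp.comp_homeomorph (phaseRegroup d).symm.toHomeomorph) (hr (ab.pos, gd.pos))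
  rw [hKeq ab gd _ hsym.smooth hsupp]
  have hcentre : (gaborCentre d (ab.pos, gd.pos)).2 = gd.pos - ab.pos := rfl
  rw [hcentre, ContinuousLinearEquiv.coe_coe] at h
  calc _ = K * ((1 + ‖gd.pos - ab.pos‖) ^ m * (1 + ‖gd.freq - ab.freq‖) ^ N * _) := by
        rw [mul_left_comm]
    _ ≤ K * _ := mul_le_mul_of_nonneg_left h hK
    _ = _ := by ring

/-- The phase space point of an index pair. -/
def Idx2.point (a : Idx2 d) : E2 d × E2 d := (a.pos, a.freq)

/-- Matrix elements decay rapidly in the row index, up to polynomial growth in the column index. -/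
theorem exists_matElem_decay {B : Fin d → Fin d → E1 d → ℝ} {g : E1 d → ℝ}
    (hB : IsRegularMagneticField d B) (hg : IsWindow d g) {p : ℕ} {D : ℕ → ℝ} {Φ : E4 d → ℂ}
    (hΦ : IsSymbol p D Φ) (n : ℕ) :
    ∃ (C : ℝ) (q : ℕ), 0 ≤ C ∧ ∀ ab gd : Idx2 d,
      (1 + ‖ab.point‖) ^ n * ‖matElem d B g Φ ab gd‖ ≤ C * (1 + ‖gd.point‖) ^ q := by
  obtain ⟨k, hk⟩ := exists_matElem_bound hB hg hΦ
    (N := p + (Module.finrank ℝ (E2 d) + 1 + n)) (by omega)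
  obtain ⟨C, hC, hb⟩ := hk (k + p + n)
  refine ⟨C, n + (k + p + p), hC, fun ab gd => ?_⟩
  have h := hb ab gd
  have hpos : ‖gd.pos‖ ≤ ‖gd.point‖ := norm_fst_le gd.point
  have hfreq : ‖gd.freq‖ ≤ ‖gd.point‖ := norm_snd_le gd.point
  have hG0 := norm_nonneg gd.point
  set G := ‖gd.point‖
  have hs0 := norm_nonneg (gd.pos - ab.pos)
  have ht0 := norm_nonneg (gd.freq - ab.freq)
  have tri : ∀ {u v : E2 d}, ‖v‖ ≤ G → ‖u‖ ≤ ‖v - u‖ + G := fun {u v} hv => by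
    have := norm_sub_le v (v - u)
    rw [sub_sub_cancel] at this
    linarith
  have h1 : ‖ab.pos‖ ≤ ‖gd.pos - ab.pos‖ + G := tri hpos
  have h2 : ‖ab.freq‖ ≤ ‖gd.freq - ab.freq‖ + G := tri hfreq
  have half : ∀ {u v : E2 d}, ‖v‖ ≤ G → ‖(2 : ℝ)⁻¹ • (u + v)‖ ≤ ‖v - u‖ + G := fun {u v} hv => by
    have e1 := tri (u := u) hv
    have e2 := norm_add_le u v
    have e3 := norm_nonneg (v - u)
    rw [norm_smul, Real.norm_of_nonneg (by norm_num)]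
    linarith
  have h3 : ‖(2 : ℝ)⁻¹ • (gd.freq + ab.freq)‖ ≤ ‖gd.freq - ab.freq‖ + G := by
    rw [add_comm gd.freq]
    exact half hfreq
  have h4 : ‖gaborCentre d (ab.pos, gd.pos)‖ ≤ ‖gd.pos - ab.pos‖ + G :=
    max_le (half hpos) (le_add_of_nonneg_right hG0)
  have h5 : ‖(ab.pos, gd.pos)‖ ≤ ‖gd.pos - ab.pos‖ + G := max_le h1 (by linarith)
  have h6 : ‖ab.point‖ ≤ max (‖gd.pos - ab.pos‖ + G) (‖gd.freq - ab.freq‖ + G) :=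
    max_le_max h1 h2
  have he := norm_nonneg (matElem d B g Φ ab gd)
  generalize ‖gd.pos - ab.pos‖ = s at *
  generalize ‖gd.freq - ab.freq‖ = t at *
  generalize ‖matElem d B g Φ ab gd‖ = e at *
  have hs : 1 + (s + G) ≤ (1 + s) * (1 + G) := by nlinarith
  have ht : 1 + (t + G) ≤ (1 + t) * (1 + G) := by nlinarith
  have hst : 1 + ‖ab.point‖ ≤ (1 + s) * (1 + t) * (1 + G) := by
    rcases le_max_iff.1 h6 with h7 | h7
    · nlinarith [mul_nonneg (mul_nonneg (add_nonneg zero_le_one hs0) ht0) (add_nonneg zero_le_one hG0)]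
    · nlinarith [mul_nonneg (mul_nonneg (add_nonneg zero_le_one ht0) hs0) (add_nonneg zero_le_one hG0)]
  have hlow : (1 + s) ^ (k + p + n) * (1 + t) ^ (p + n) * e
      ≤ C * ((1 + s) * (1 + G)) ^ k * ((1 + s) * (1 + G)) ^ p * ((1 + t) * (1 + G)) ^ p := by
    calc (1 + s) ^ (k + p + n) * (1 + t) ^ (p + n) * e
        ≤ (1 + s) ^ (k + p + n) * (1 + t) ^ (p + (Module.finrank ℝ (E2 d) + 1 + n)) * e := by
          gcongr
          · linarith
          · omega
      _ ≤ _ := h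
      _ ≤ _ := by
          gcongr
          · linarith
          · linarith
          · linarith
  have hcancel : (1 + s) ^ (k + p) * (1 + t) ^ p * ((1 + s) ^ n * (1 + t) ^ n * e)
      ≤ (1 + s) ^ (k + p) * (1 + t) ^ p * (C * (1 + G) ^ (k + p + p)) := by
    refine (Eq.trans_le ?_ hlow).trans_eq ?_ <;> simp only [mul_pow, pow_add] <;> ring
  have hfin := le_of_mul_le_mul_left hcancel (by positivity)
  calc (1 + ‖ab.point‖) ^ n * e ≤ ((1 + s) * (1 + t) * (1 + G)) ^ n * e := by gcongr
    _ = (1 + G) ^ n * ((1 + s) ^ n * (1 + t) ^ n * e) := by simp only [mul_pow]; ring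
    _ ≤ (1 + G) ^ n * (C * (1 + G) ^ (k + p + p)) := by gcongr
    _ = C * (1 + G) ^ (n + (k + p + p)) := by rw [pow_add (1 + G) n]; ring

end MatrixElement

section FrameCoefficient

/-- Localising a Schwartz function far from the origin yields rapidly decaying integrals. -/
theorem SchwartzMap.exists_integral_iteratedFDeriv_mul_le {V : Type*} [NormedAddCommGroup V]
    [NormedSpace ℝ V] [FiniteDimensional ℝ V] [MeasureSpace V] [BorelSpace V]
    [(volume : Measure V).IsAddHaarMeasure] (F : SchwartzMap (V × V) ℂ) (n m : ℕ) :
    ∃ S : ℝ, 0 ≤ S ∧ ∀ (r : V × V → ℂ) (q : V × V) (Q : ℝ), IsLocalAmplitude n q Q r →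
      (1 + ‖q‖) ^ m * ∫ x, ‖iteratedFDeriv ℝ n (fun x => F x * r x) x‖ ≤ S * Q := by
  set s : ℝ := 2 ^ m * (Finset.Iic (m, n)).sup (fun m => SchwartzMap.seminorm ℝ m.1 m.2) F
  have hs : 0 ≤ s := by positivity
  have hF : ∀ k ≤ n, ∀ x, (1 + ‖x‖) ^ m * ‖iteratedFDeriv ℝ k F x‖ ≤ s := fun k hk x =>
    SchwartzMap.one_add_le_sup_seminorm_apply (𝕜 := ℝ) (m := (m, n)) le_rfl hk F x
  refine ⟨3 ^ m * (volume.real (Metric.closedBall (0 : V × V) 2) * (2 ^ n * s)), by positivity,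
    fun r q Q hr => ?_⟩
  have hQ := hr.nonneg
  have h := integral_norm_iteratedFDeriv_le_of_tsupport_subset (f := fun x => F x * r x) (c := q)
    (R := 2) (B := 2 ^ n * (s * 3 ^ m / (1 + ‖q‖) ^ m) * Q) (k := n)
    ((closure_mono (Function.support_mul_subset_right _ _)).trans hr.tsupport_subset)
    fun w hw => by
      refine norm_iteratedFDeriv_mul_le_of_bounds F.smooth' hr.smooth (fun k hk => ?_)
        (fun k hk => hr.bound k hk w) le_rfl
      have hqw : 1 + ‖q‖ ≤ 3 * (1 + ‖w‖) := by
        rw [Metric.mem_closedBall, dist_comm, dist_eq_norm] at hw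
        have := norm_le_norm_add_norm_sub' q w
        linarith [norm_nonneg w]
      rw [le_div_iff₀ (by positivity)]
      calc ‖iteratedFDeriv ℝ k F w‖ * (1 + ‖q‖) ^ m
          ≤ ‖iteratedFDeriv ℝ k F w‖ * (3 * (1 + ‖w‖)) ^ m := by gcongr
        _ = (1 + ‖w‖) ^ m * ‖iteratedFDeriv ℝ k F w‖ * 3 ^ m := by rw [mul_pow]; ring
        _ ≤ s * 3 ^ m := by gcongr; exact hF k hk w
  refine (mul_le_mul_of_nonneg_left h (by positivity)).trans_eq ?_
  field_simp

variable {d : ℕ}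

/-- The amplitude of the frame coefficient, at `(x, q)` where `q` is the position of the index. -/
def frameAmplitude (d : ℕ) (B : Fin d → Fin d → E1 d → ℝ) (g : E1 d → ℝ)
    (p : E2 d × E2 d) : ℂ :=
  Complex.exp (Complex.I * ((magPhi d B p.1.2 p.2.2 - magPhi d B p.1.1 p.2.1 : ℝ) : ℂ)) *
    ((g (p.1.1 - p.2.1) * g (p.1.2 - p.2.2) : ℝ) : ℂ)

theorem hasTemperateGrowth_frameAmplitude {B : Fin d → Fin d → E1 d → ℝ} {g : E1 d → ℝ}
    (hB : IsRegularMagneticField d B) (hg : IsWindow d g) :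
    (frameAmplitude d B g).HasTemperateGrowth := by
  have hid : (fun q : E2 d × E2 d => q).HasTemperateGrowth := Function.HasTemperateGrowth.id'
  have hphase := (hB.hasTemperateGrowth_magPhi_comp hid.fst.snd hid.snd.snd).fun_sub
    (hB.hasTemperateGrowth_magPhi_comp hid.fst.fst hid.snd.fst)
  have hcut := (hg.hasTemperateGrowth.comp (hid.fst.fst.fun_sub hid.snd.fst)).fun_mul
    (hg.hasTemperateGrowth.comp (hid.fst.snd.fun_sub hid.snd.snd))
  exact (hasTemperateGrowth_cexp_I_mul.comp hphase).fun_mul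
    (Complex.ofRealCLM.hasTemperateGrowth.comp hcut)

theorem frameAmplitude_support {B : Fin d → Fin d → E1 d → ℝ} {g : E1 d → ℝ}
    (hg : IsWindow d g) (w q : E2 d) (h : frameAmplitude d B g (w, q) ≠ 0) : ‖w - q‖ ≤ 2 := by
  have h1 := Complex.ofReal_ne_zero.1 (right_ne_zero_of_mul h)
  refine (max_le (hg.norm_le_one (left_ne_zero_of_mul h1))
    (hg.norm_le_one (right_ne_zero_of_mul h1)) : ‖w - q‖ ≤ 1).trans one_le_two

theorem frameCoef_eq (B : Fin d → Fin d → E1 d → ℝ) (g : E1 d → ℝ) (a : Idx2 d) (F : E2 d → ℂ) :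
    frameCoef d B g a.1 a.2 F = ((((2 * Real.pi) ^ (-(d : ℝ) / 2) : ℝ) : ℂ) ^ 2 *
        Complex.exp (Complex.I * ((splitForm d a.freq a.pos : ℝ) : ℂ))) *
      ∫ x, Complex.exp (Complex.I * (((-splitForm d a.freq) x : ℝ) : ℂ)) *
        (F x * frameAmplitude d B g (x, a.pos)) := by
  rw [frameCoef, ← integral_const_mul]
  congr 1
  funext x
  rw [conj_gabor_eq, gabor_eq, frameAmplitude]
  have key : ∀ (c f : ℂ) (g₁ g₂ t₁ t₂ s₁ s₂ s₃ : ℝ), t₁ + t₂ = s₁ + s₂ + s₃ →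
      f * (c * Complex.exp (Complex.I * (t₁ : ℂ)) * (g₁ : ℂ)) *
        (c * Complex.exp (Complex.I * (t₂ : ℂ)) * (g₂ : ℂ))
        = (c ^ 2 * Complex.exp (Complex.I * (s₁ : ℂ))) * (Complex.exp (Complex.I * (s₂ : ℂ)) *
          (f * (Complex.exp (Complex.I * (s₃ : ℂ)) * ((g₁ * g₂ : ℝ) : ℂ)))) := by
    intro c f g₁ g₂ t₁ t₂ s₁ s₂ s₃ h
    have h1 : Complex.exp (Complex.I * ((t₁ + t₂ : ℝ) : ℂ))
        = Complex.exp (Complex.I * ((s₁ + s₂ + s₃ : ℝ) : ℂ)) := by rw [h]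
    simp only [← cexp_I_mul_mul_cexp_I_mul] at h1
    push_cast
    linear_combination (c ^ 2 * f * (g₁ * g₂)) * h1
  dsimp only [Idx2.pos]
  generalize magPhi d B x.1 _ = m₁
  generalize magPhi d B x.2 _ = m₂
  generalize g (x.1 - _) = g₁
  generalize g (x.2 - _) = g₂
  refine key _ _ _ _ _ _ _ _ _ ?_
  simp only [Idx2.freq, splitForm, sub_apply, neg_apply,
    ContinuousLinearMap.bilinearComp_apply, ContinuousLinearMap.coe_fst',
    ContinuousLinearMap.coe_snd', map_sub]
  ring

/-- Frame coefficients of Schwartz functions decay rapidly. -/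
theorem exists_frameCoef_decay {B : Fin d → Fin d → E1 d → ℝ} {g : E1 d → ℝ}
    (hB : IsRegularMagneticField d B) (hg : IsWindow d g) (F : SchwartzMap (E2 d) ℂ) (n : ℕ) :
    ∃ C : ℝ, 0 ≤ C ∧ ∀ a : Idx2 d, (1 + ‖a.point‖) ^ n * ‖frameCoef d B g a.1 a.2 F‖ ≤ C := by
  obtain ⟨C₀, k, hC₀, hr⟩ := (hasTemperateGrowth_frameAmplitude hB hg).exists_isLocalAmplitude
    (V := E1 d) (ContinuousLinearMap.id ℝ (E2 d)) (frameAmplitude_support hg) n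
  obtain ⟨S₀, hS₀, h₀⟩ := F.exists_integral_iteratedFDeriv_mul_le 0 (k + n)
  obtain ⟨S₁, hS₁, h₁⟩ := F.exists_integral_iteratedFDeriv_mul_le n (k + n)
  set κ : ℝ := ((2 * Real.pi) ^ (-(d : ℝ) / 2)) ^ 2 with hκ
  refine ⟨κ * (2 ^ n * ((S₀ + S₁) * C₀)), by positivity, fun a => ?_⟩
  have hra := hr a.pos
  rw [ContinuousLinearMap.id_apply] at hra
  set r : E2 d → ℂ := fun w => frameAmplitude d B g (w, a.pos)
  have h₀' := h₀ r a.pos _ ⟨hra.smooth, hra.support, fun k hk => hra.bound k (hk.trans n.zero_le)⟩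
  have h₁' := h₁ r a.pos _ hra
  obtain ⟨u, hu, hu'⟩ := exists_splitForm_eq_norm a.freq
  have hf : ContDiff ℝ ∞ fun x => F x * r x := F.smooth'.mul hra.smooth
  have hfc : HasCompactSupport fun x => F x * r x := hra.hasCompactSupport.mul_left
  have e₀ := pow_abs_mul_norm_integral_cexp_mul_le (-splitForm d a.freq) hu 0 hf hfc
  have e₁ := pow_abs_mul_norm_integral_cexp_mul_le (-splitForm d a.freq) hu n hf hfc
  rw [neg_apply, hu', abs_neg, abs_norm] at e₀ e₁
  rw [frameCoef_eq, norm_mul, norm_mul, norm_pow, norm_cexp_I_mul, Complex.norm_real,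
    Real.norm_of_nonneg (by positivity), mul_one, ← hκ]
  set J := ‖∫ x, Complex.exp (Complex.I * (((-splitForm d a.freq) x : ℝ) : ℂ)) * (F x * r x)‖
  have hJ : 0 ≤ J := norm_nonneg _
  have hpoint : 1 + ‖a.point‖ ≤ (1 + ‖a.pos‖) * (1 + ‖a.freq‖) := by
    have : ‖a.point‖ ≤ ‖a.pos‖ + ‖a.freq‖ :=
      max_le (le_add_of_nonneg_right (norm_nonneg _)) (le_add_of_nonneg_left (norm_nonneg _))
    nlinarith [mul_nonneg (norm_nonneg a.pos) (norm_nonneg a.freq)]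
  have hpow : (1 + ‖a.freq‖) ^ n ≤ 2 ^ n * (1 + ‖a.freq‖ ^ n) := by
    refine (add_pow_le zero_le_one (norm_nonneg _) n).trans ?_
    rw [one_pow]
    gcongr
    · exact one_le_two
    · omega
  have hsum : (1 + ‖a.pos‖) ^ (k + n) * ((1 + ‖a.freq‖ ^ n) * J)
      ≤ (S₀ + S₁) * (C₀ * (1 + ‖a.pos‖) ^ k) := by
    calc (1 + ‖a.pos‖) ^ (k + n) * ((1 + ‖a.freq‖ ^ n) * J)
        = (1 + ‖a.pos‖) ^ (k + n) * (‖a.freq‖ ^ 0 * J)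
          + (1 + ‖a.pos‖) ^ (k + n) * (‖a.freq‖ ^ n * J) := by ring
      _ ≤ S₀ * (C₀ * (1 + ‖a.pos‖) ^ k) + S₁ * (C₀ * (1 + ‖a.pos‖) ^ k) :=
        add_le_add ((mul_le_mul_of_nonneg_left e₀ (by positivity)).trans h₀')
          ((mul_le_mul_of_nonneg_left e₁ (by positivity)).trans h₁')
      _ = _ := by ring
  have hsum' : (1 + ‖a.pos‖) ^ n * ((1 + ‖a.freq‖ ^ n) * J) ≤ (S₀ + S₁) * C₀ := by
    refine le_of_mul_le_mul_left ((Eq.trans_le ?_ hsum).trans_eq ?_)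
      (show 0 < (1 + ‖a.pos‖) ^ k by positivity) <;> ring
  calc (1 + ‖a.point‖) ^ n * (κ * J)
      ≤ ((1 + ‖a.pos‖) * (1 + ‖a.freq‖)) ^ n * (κ * J) := by gcongr
    _ = κ * ((1 + ‖a.pos‖) ^ n * ((1 + ‖a.freq‖) ^ n * J)) := by rw [mul_pow]; ring
    _ ≤ κ * ((1 + ‖a.pos‖) ^ n * (2 ^ n * (1 + ‖a.freq‖ ^ n) * J)) := by gcongr
    _ = κ * (2 ^ n * ((1 + ‖a.pos‖) ^ n * ((1 + ‖a.freq‖ ^ n) * J))) := by ring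
    _ ≤ _ := by gcongr

end FrameCoefficient

section Summation

variable {d : ℕ}

theorem exists_summable_inv_one_add_norm_intCast_pow (d : ℕ) :
    ∃ K : ℕ, Summable fun v : Fin d → ℤ => ((1 + ‖fun i => (v i : ℝ)‖) ^ K)⁻¹ := by
  let L := Submodule.span ℤ (Set.range (Pi.basisFun ℝ (Fin d)))
  let c : (Fin d → ℤ) → L := fun v => ⟨fun i => (v i : ℝ),
    ((Pi.basisFun ℝ (Fin d)).mem_span_iff_repr_mem ℤ _).2 fun i => ⟨v i, by simp⟩⟩
  have hc : Function.Injective c := fun v w h => funext fun i => by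
    simpa [c] using congrFun (Subtype.ext_iff.1 h) i
  refine ⟨Module.finrank ℤ L + 1, ?_⟩
  have h := ((ZLattice.summable_norm_pow_inv L _ (Nat.lt_succ_self _)).add
    (hasSum_ite_eq (0 : L) (1 : ℝ)).summable).comp_injective hc
  refine h.of_nonneg_of_le (fun v => by positivity) fun v => ?_
  change ((1 + ‖c v‖) ^ _)⁻¹ ≤ ‖c v‖⁻¹ ^ _ + ite (c v = 0) 1 0
  split_ifs with hv
  · simp [hv]
  · have : 0 < ‖c v‖ := norm_pos_iff.2 hv
    rw [add_zero, inv_pow]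
    gcongr
    linarith

theorem exists_summable_inv_one_add_norm_point_pow (d : ℕ) :
    ∃ K : ℕ, Summable fun a : Idx2 d => ((1 + ‖a.point‖) ^ K)⁻¹ := by
  obtain ⟨K, hK⟩ := exists_summable_inv_one_add_norm_intCast_pow d
  have h2 := hK.mul_of_nonneg hK (fun v => by positivity) fun v => by positivity
  have h4 := h2.mul_of_nonneg h2 (fun v => by positivity) fun v => by positivity
  refine ⟨4 * K, h4.of_nonneg_of_le (fun a => by positivity) fun a => ?_⟩
  simp only [← mul_inv, ← mul_pow]
  have h : ∀ x : E1 d, ‖x‖ ≤ ‖a.point‖ → 1 + ‖x‖ ≤ 1 + ‖a.point‖ := fun x hx => by linarith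
  have h₁ := h _ ((norm_fst_le a.pos).trans (norm_fst_le a.point))
  have h₂ := h _ ((norm_snd_le a.pos).trans (norm_fst_le a.point))
  have h₃ := h _ ((norm_fst_le a.freq).trans (norm_snd_le a.point))
  have h₄ := h _ ((norm_snd_le a.freq).trans (norm_snd_le a.point))
  rw [pow_mul]
  gcongr
  calc _ ≤ ((1 + ‖a.point‖) * (1 + ‖a.point‖)) * ((1 + ‖a.point‖) * (1 + ‖a.point‖)) :=
        mul_le_mul (mul_le_mul h₁ h₃ (by positivity) (by positivity))
          (mul_le_mul h₂ h₄ (by positivity) (by positivity)) (by positivity) (by positivity)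
    _ = _ := by ring

theorem jbIdxPair_le (a : Idx2 d) : jbIdxPair d a.1 a.2 ≤ (1 + 4 * d) * (1 + ‖a.point‖) := by
  have h := norm_phaseRegroup_symm_apply a.point
  rw [← h]
  exact jbE4_le ((phaseRegroup d).symm a.point)

theorem exists_matElem_mul_frameCoef_le {B : Fin d → Fin d → E1 d → ℝ} {g : E1 d → ℝ}
    {Φ : E4 d → ℂ} {p : ℕ} {D : ℕ → ℝ} (hB : IsRegularMagneticField d B) (hg : IsWindow d g)
    (hΦ : IsSymbol p D Φ) (F : SchwartzMap (E2 d) ℂ) (n K : ℕ) :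
    ∃ C, 0 ≤ C ∧ ∀ ab gd : Idx2 d, (1 + ‖ab.point‖) ^ n *
      ‖matElem d B g Φ ab gd * frameCoef d B g gd.1 gd.2 ⇑F‖ ≤
        C * ((1 + ‖gd.point‖) ^ K)⁻¹ := by
  obtain ⟨C, q, hC, hM⟩ := exists_matElem_decay hB hg hΦ n
  obtain ⟨C', hC', hF⟩ := exists_frameCoef_decay hB hg F (q + K)
  refine ⟨C * C', mul_nonneg hC hC', fun ab gd => ?_⟩
  have hK : 0 < (1 + ‖gd.point‖) ^ K := by positivity
  rw [norm_mul, ← mul_assoc, ← div_eq_mul_inv, le_div_iff₀ hK]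
  calc _ ≤ C * (1 + ‖gd.point‖) ^ q * ‖frameCoef d B g gd.1 gd.2 ⇑F‖ * (1 + ‖gd.point‖) ^ K := by
        exact mul_le_mul_of_nonneg_right
          (mul_le_mul_of_nonneg_right (hM ab gd) (norm_nonneg _)) hK.le
    _ = C * ((1 + ‖gd.point‖) ^ (q + K) * ‖frameCoef d B g gd.1 gd.2 ⇑F‖) := by ring
    _ ≤ C * C' := by gcongr; exact hF gd

end Summation

end Auxiliary

/-- in frame coordinates, `Op^A(Φ)` with `Φ ∈ S₀(M)` maps smoothing
operators to smoothing operators: the matrix of `Φ` applied to super-polynomially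
decaying coefficients is absolutely summable and again decays super-polynomially. -/
theorem statement17 (d : ℕ) (hd : 0 < d) (B : Fin d → Fin d → (Fin d → ℝ) → ℝ)
    (hB : IsRegularMagneticField d B) (g : (Fin d → ℝ) → ℝ) (hg : IsWindow d g)
    (M : E4 d → ℝ) (hM : IsTemperedWeightE4 d M)
    (Φ : E4 d → ℂ) (hΦ : InS0 d M Φ) (F : SchwartzMap (E2 d) ℂ) :
    (∀ ab : Idx2 d, Summable fun gd : Idx2 d =>
        ‖matElem d B g Φ ab gd * frameCoef d B g gd.1 gd.2 ⇑F‖) ∧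
    (∀ n : ℕ, ∃ C : ℝ, ∀ ab : Idx2 d,
        jbIdxPair d ab.1 ab.2 ^ n *
          ‖∑' gd : Idx2 d, matElem d B g Φ ab gd * frameCoef d B g gd.1 gd.2 ⇑F‖ ≤ C) := by
  obtain ⟨p, D, hΦ'⟩ := hΦ.exists_isSymbol hM
  obtain ⟨K, hK⟩ := exists_summable_inv_one_add_norm_point_pow d
  have hsum : ∀ ab : Idx2 d, Summable fun gd : Idx2 d =>
      ‖matElem d B g Φ ab gd * frameCoef d B g gd.1 gd.2 ⇑F‖ := fun ab => by
    obtain ⟨C, -, h⟩ := exists_matElem_mul_frameCoef_le hB hg hΦ' F 0 K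
    exact (hK.mul_left C).of_nonneg_of_le (fun _ => norm_nonneg _) fun gd => by
      simpa using h ab gd
  refine ⟨hsum, fun n => ?_⟩
  obtain ⟨C, hC, h⟩ := exists_matElem_mul_frameCoef_le hB hg hΦ' F n K
  refine ⟨(1 + 4 * d) ^ n * (C * ∑' gd : Idx2 d, ((1 + ‖gd.point‖) ^ K)⁻¹), fun ab => ?_⟩
  have hjb : jbIdxPair d ab.1 ab.2 ^ n ≤ (1 + 4 * d) ^ n * (1 + ‖ab.point‖) ^ n := by
    rw [← mul_pow]
    exact pow_le_pow_left₀ (Real.sqrt_nonneg _) (jbIdxPair_le ab) n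
  refine (mul_le_mul hjb (norm_tsum_le_tsum_norm (hsum ab)) (norm_nonneg _)
    (by positivity)).trans ?_
  rw [mul_assoc]
  refine mul_le_mul_of_nonneg_left ?_ (by positivity)
  rw [← tsum_mul_left, ← tsum_mul_left]
  exact Summable.tsum_le_tsum (h ab) ((hsum ab).mul_left _) (hK.mul_left C)
end
end

section
/- Let M₁ and M₂ be tempered weights on ℝ^N and let A, B : ℤ^N × ℤ^N → ℂ satisfy: for every n ∈ ℕ there exist constants C_n, C'_n > 0 such that |A_{u,v}| ≤ C_n · ⟨u−v⟩^{−n} · M₁((u+v)/2) and |B_{u,v}| ≤ C'_n · ⟨u−v⟩^{−n} · M₂((u+v)/2) for all u, v ∈ ℤ^N. Then for all u, v ∈ ℤ^N the matrix-product entry C_{u,v} := Σ_{w∈ℤ^N} A_{u,w} · B_{w,v} converges absolutely, and for every n ∈ ℕ there exists C'' > 0 such that |C_{u,v}| ≤ C'' · ⟨u−v⟩^{−n} · M₁((u+v)/2) · M₂((u+v)/2) for all u, v ∈ ℤ^N. (This is the discrete estimate behind the statement that the magnetic super Weyl product maps S₀(M₁) × S₀(M₂) into S₀(M₁M₂).)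 -/
open MeasureTheory Filter
open scoped ENNReal

noncomputable section

lemma one_le_jbV {N : ℕ} (v : Fin N → ℝ) : 1 ≤ jbV v :=
  Real.one_le_sqrt.2 (le_add_of_nonneg_right (Finset.sum_nonneg fun _ _ => sq_nonneg _))

lemma jbV_pos {N : ℕ} (v : Fin N → ℝ) : 0 < jbV v :=
  zero_lt_one.trans_le (one_le_jbV v)

lemma jbV_sq {N : ℕ} (v : Fin N → ℝ) : jbV v ^ 2 = 1 + ∑ i, v i ^ 2 :=
  Real.sq_sqrt (by positivity)

lemma jbV_le_of_abs_le {N : ℕ} {v w : Fin N → ℝ} (h : ∀ i, |v i| ≤ |w i|) :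
    jbV v ≤ jbV w :=
  Real.sqrt_le_sqrt (by gcongr 1 + ∑ i, ?_; exact sq_le_sq.2 (h _))

/-- Peetre's inequality, up to a non-optimal constant. -/
lemma jbV_add_le {N : ℕ} (v w : Fin N → ℝ) : jbV (v + w) ≤ 2 * (jbV v * jbV w) := by
  have hv := jbV_pos v
  have hw := jbV_pos w
  refine (sq_le_sq₀ (jbV_pos _).le (by positivity)).1 ?_
  rw [mul_pow, mul_pow, jbV_sq, jbV_sq, jbV_sq]
  have h : ∑ i, (v + w) i ^ 2 ≤ 2 * ∑ i, v i ^ 2 + 2 * ∑ i, w i ^ 2 := by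
    rw [Finset.mul_sum, Finset.mul_sum, ← Finset.sum_add_distrib]
    refine Finset.sum_le_sum fun i _ => ?_
    simp only [Pi.add_apply]
    nlinarith [sq_nonneg (v i - w i)]
  have hv' : 0 ≤ ∑ i, v i ^ 2 := by positivity
  have hw' : 0 ≤ ∑ i, w i ^ 2 := by positivity
  nlinarith [mul_nonneg hv' hw']

lemma summable_prod_pi_of_nonneg {α : Type*} {g : α → ℝ} (hg : Summable g) (h0 : ∀ a, 0 ≤ g a)
    (N : ℕ) : Summable fun w : Fin N → α => ∏ i, g (w i) := by
  induction N with
  | zero => exact Summable.of_finite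
  | succ N ih =>
    rw [← (Fin.consEquiv fun _ => α).summable_iff]
    refine (hg.mul_of_nonneg ih h0 fun w => Finset.prod_nonneg fun i _ => h0 _).congr fun p => ?_
    simp [Fin.prod_univ_succ, Fin.consEquiv]

lemma summable_inv_one_add_int_sq : Summable fun k : ℤ => (1 + (k : ℝ) ^ 2)⁻¹ := by
  refine Summable.of_norm_bounded_eventually
    (Real.summable_one_div_int_pow.2 (by norm_num : 1 < 2)) ?_
  filter_upwards [(Set.finite_singleton (0 : ℤ)).compl_mem_cofinite] with k hk
  have hk' : (k : ℝ) ≠ 0 := Int.cast_ne_zero.2 hk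
  rw [Real.norm_of_nonneg (by positivity), one_div]
  gcongr
  linarith

lemma summable_inv_jbV_pow (N : ℕ) :
    Summable fun w : Fin N → ℤ => (jbV (fun i => (w i : ℝ)) ^ (2 * N))⁻¹ := by
  refine .of_nonneg_of_le (fun w => inv_nonneg.2 (pow_nonneg (jbV_pos _).le _)) (fun w => ?_)
    (summable_prod_pi_of_nonneg summable_inv_one_add_int_sq (fun k => by positivity) N)
  rw [Finset.prod_inv_distrib, pow_mul, jbV_sq]
  refine inv_anti₀ (Finset.prod_pos fun i _ => by positivity) ?_
  calc ∏ i, (1 + (w i : ℝ) ^ 2) ≤ ∏ _i : Fin N, (1 + ∑ j, (w j : ℝ) ^ 2) := by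
        refine Finset.prod_le_prod (fun i _ => by positivity) fun i _ => ?_
        gcongr
        exact Finset.single_le_sum (f := fun j => (w j : ℝ) ^ 2) (fun _ _ => sq_nonneg _)
          (Finset.mem_univ i)
    _ = _ := by simp

lemma IsTemperedWeight.exists_le_mul_pow {N : ℕ} {m : (Fin N → ℝ) → ℝ} (hm : IsTemperedWeight m) :
    ∃ C > 0, ∃ k : ℕ, ∀ x y z : Fin N → ℝ, (∀ i, |x i - y i| ≤ |z i|) →
      m x ≤ C * m y * jbV z ^ k := by
  obtain ⟨hpos, C, hC, a, ha, h⟩ := hm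
  obtain ⟨k, hk⟩ := exists_nat_ge a
  refine ⟨C, hC, k, fun x y z hz => ?_⟩
  have hy := hpos y
  calc m x = m (y + (x - y)) := by rw [add_sub_cancel]
    _ ≤ C * m y * jbV (x - y) ^ a := h _ _
    _ ≤ C * m y * jbV z ^ a := by
        gcongr
        · exact (jbV_pos _).le
        · exact jbV_le_of_abs_le hz
    _ ≤ C * m y * jbV z ^ k := by
        rw [← Real.rpow_natCast]
        gcongr
        exact one_le_jbV z

/-- Termwise bound for the product of two matrices with off-diagonal decay relative to
tempered weights; it is summable in `w`, uniformly in `u` and `v`. -/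
lemma exists_norm_mul_le_of_offDiagonalDecay {N : ℕ} {M₁ M₂ : (Fin N → ℝ) → ℝ}
    (hM₁ : IsTemperedWeight M₁) (hM₂ : IsTemperedWeight M₂)
    {A B : (Fin N → ℤ) → (Fin N → ℤ) → ℂ}
    (hA : ∀ n : ℕ, ∃ C > 0, ∀ u v : Fin N → ℤ,
        ‖A u v‖ ≤ C * M₁ (fun i => ((u i + v i : ℤ) : ℝ) / 2)
          / jbV (fun i => ((u i - v i : ℤ) : ℝ)) ^ n)
    (hB : ∀ n : ℕ, ∃ C > 0, ∀ u v : Fin N → ℤ,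
        ‖B u v‖ ≤ C * M₂ (fun i => ((u i + v i : ℤ) : ℝ) / 2)
          / jbV (fun i => ((u i - v i : ℤ) : ℝ)) ^ n) (n : ℕ) :
    ∃ C > 0, ∀ u v w : Fin N → ℤ, ‖A u w * B w v‖ ≤
      C * M₁ (fun i => ((u i + v i : ℤ) : ℝ) / 2) * M₂ (fun i => ((u i + v i : ℤ) : ℝ) / 2)
        / jbV (fun i => ((u i - v i : ℤ) : ℝ)) ^ n
        * (jbV (fun i => ((u i - w i : ℤ) : ℝ)) ^ (2 * N))⁻¹ := by
  obtain ⟨c₁, hc₁, k₁, h₁⟩ := hM₁.exists_le_mul_pow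
  obtain ⟨c₂, hc₂, k₂, h₂⟩ := hM₂.exists_le_mul_pow
  obtain ⟨a, ha, hA⟩ := hA (k₂ + n + 2 * N)
  obtain ⟨b, hb, hB⟩ := hB (k₁ + n)
  refine ⟨a * c₁ * (b * c₂) * 2 ^ n, by positivity, fun u v w => ?_⟩
  have hm₁ := h₁ (fun i => ((u i + w i : ℤ) : ℝ) / 2) (fun i => ((u i + v i : ℤ) : ℝ) / 2)
    (fun i => ((w i - v i : ℤ) : ℝ)) fun i => by
      rw [show ((u i + w i : ℤ) : ℝ) / 2 - ((u i + v i : ℤ) : ℝ) / 2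
        = ((w i - v i : ℤ) : ℝ) / 2 by push_cast; ring, abs_div, abs_two]
      exact half_le_self (abs_nonneg _)
  have hm₂ := h₂ (fun i => ((w i + v i : ℤ) : ℝ) / 2) (fun i => ((u i + v i : ℤ) : ℝ) / 2)
    (fun i => ((u i - w i : ℤ) : ℝ)) fun i => by
      rw [show ((w i + v i : ℤ) : ℝ) / 2 - ((u i + v i : ℤ) : ℝ) / 2
        = -(((u i - w i : ℤ) : ℝ) / 2) by push_cast; ring, abs_neg, abs_div, abs_two]
      exact half_le_self (abs_nonneg _)
  have hJ := jbV_add_le (fun i => ((u i - w i : ℤ) : ℝ)) (fun i => ((w i - v i : ℤ) : ℝ))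
  rw [show (fun i => ((u i - w i : ℤ) : ℝ)) + (fun i => ((w i - v i : ℤ) : ℝ))
    = fun i => ((u i - v i : ℤ) : ℝ) by ext i; simp] at hJ
  have hA := hA u w
  have hB := hB w v
  have hp₁ := hM₁.1 (fun i => ((u i + v i : ℤ) : ℝ) / 2)
  have hp₂ := hM₂.1 (fun i => ((u i + v i : ℤ) : ℝ) / 2)
  have hq₂ := hM₂.1 (fun i => ((w i + v i : ℤ) : ℝ) / 2)
  have hx := jbV_pos (fun i => ((u i - w i : ℤ) : ℝ))
  have hy := jbV_pos (fun i => ((w i - v i : ℤ) : ℝ))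
  have hz := jbV_pos (fun i => ((u i - v i : ℤ) : ℝ))
  generalize jbV (fun i => ((u i - w i : ℤ) : ℝ)) = x at *
  generalize jbV (fun i => ((w i - v i : ℤ) : ℝ)) = y at *
  generalize jbV (fun i => ((u i - v i : ℤ) : ℝ)) = z at *
  generalize M₁ (fun i => ((u i + v i : ℤ) : ℝ) / 2) = m₁ at *
  generalize M₂ (fun i => ((u i + v i : ℤ) : ℝ) / 2) = m₂ at *
  calc ‖A u w * B w v‖ = ‖A u w‖ * ‖B w v‖ := norm_mul _ _
    _ ≤ (a * (c₁ * m₁ * y ^ k₁) / x ^ (k₂ + n + 2 * N))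
        * (b * (c₂ * m₂ * x ^ k₂) / y ^ (k₁ + n)) := by
        gcongr
        · exact hA.trans (by gcongr)
        · exact hB.trans (by gcongr)
    _ = a * c₁ * (b * c₂) * 2 ^ n * m₁ * m₂ / (2 * (x * y)) ^ n * (x ^ (2 * N))⁻¹ := by
        field_simp
        ring
    _ ≤ _ := by gcongr

/-- the discrete estimate behind the super Weyl product
`S₀(M₁) #ᴮ S₀(M₂) ⊆ S₀(M₁M₂)`: matrices with off-diagonal decay relative to `M₁`
and `M₂` compose, and the product has off-diagonal decay relative to `M₁·M₂`. -/
theorem statement18 (N : ℕ) (hN : 0 < N) (M₁ M₂ : (Fin N → ℝ) → ℝ)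
    (hM₁ : IsTemperedWeight M₁) (hM₂ : IsTemperedWeight M₂)
    (A B : (Fin N → ℤ) → (Fin N → ℤ) → ℂ)
    (hA : ∀ n : ℕ, ∃ C > 0, ∀ u v : Fin N → ℤ,
        ‖A u v‖ ≤ C * M₁ (fun i => ((u i + v i : ℤ) : ℝ) / 2)
          / jbV (fun i => ((u i - v i : ℤ) : ℝ)) ^ n)
    (hB : ∀ n : ℕ, ∃ C > 0, ∀ u v : Fin N → ℤ,
        ‖B u v‖ ≤ C * M₂ (fun i => ((u i + v i : ℤ) : ℝ) / 2)
          / jbV (fun i => ((u i - v i : ℤ) : ℝ)) ^ n) :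
    (∀ u v : Fin N → ℤ, Summable fun w : Fin N → ℤ => ‖A u w * B w v‖) ∧
    (∀ n : ℕ, ∃ C > 0, ∀ u v : Fin N → ℤ,
        ‖∑' w : Fin N → ℤ, A u w * B w v‖ ≤
          C * M₁ (fun i => ((u i + v i : ℤ) : ℝ) / 2)
            * M₂ (fun i => ((u i + v i : ℤ) : ℝ) / 2)
            / jbV (fun i => ((u i - v i : ℤ) : ℝ)) ^ n) := by
  have hsum (u : Fin N → ℤ) :
      Summable fun w : Fin N → ℤ => (jbV (fun i => ((u i - w i : ℤ) : ℝ)) ^ (2 * N))⁻¹ :=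
    (Equiv.subLeft u).summable_iff.2 (summable_inv_jbV_pow N)
  have htsum (u : Fin N → ℤ) :
      ∑' w : Fin N → ℤ, (jbV (fun i => ((u i - w i : ℤ) : ℝ)) ^ (2 * N))⁻¹
        = ∑' w : Fin N → ℤ, (jbV (fun i => (w i : ℝ)) ^ (2 * N))⁻¹ :=
    (Equiv.subLeft u).tsum_eq fun w : Fin N → ℤ => (jbV (fun i => (w i : ℝ)) ^ (2 * N))⁻¹
  have hpos : 0 < ∑' w : Fin N → ℤ, (jbV (fun i => (w i : ℝ)) ^ (2 * N))⁻¹ :=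
    (summable_inv_jbV_pow N).tsum_pos (fun w => inv_nonneg.2 (pow_nonneg (jbV_pos _).le _)) 0
      (inv_pos.2 (pow_pos (jbV_pos _) _))
  refine ⟨fun u v => ?_, fun n => ?_⟩
  · obtain ⟨C, -, h⟩ := exists_norm_mul_le_of_offDiagonalDecay hM₁ hM₂ hA hB 0
    exact .of_nonneg_of_le (fun _ => norm_nonneg _) (h u v) ((hsum u).mul_left _)
  · obtain ⟨C, hC, h⟩ := exists_norm_mul_le_of_offDiagonalDecay hM₁ hM₂ hA hB n
    refine ⟨C * ∑' w : Fin N → ℤ, (jbV (fun i => (w i : ℝ)) ^ (2 * N))⁻¹, mul_pos hC hpos,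
      fun u v => ?_⟩
    refine (tsum_of_norm_bounded ((hsum u).mul_left _).hasSum (h u v)).trans_eq ?_
    rw [tsum_mul_left, htsum]
    ring
end
end
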